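/- arXiv:1310.0239 — 4 statements merged into one kernel-verified Lean document; each statement's English description precedes it below -/
import Mathlib

section
/- Let d ≥ 2 be an integer and p ∈ ℝ. For every smooth function f : ℝ^{d-1} × ℝ → ℝ with compact support contained in ℝ^{d-1} × (0,∞), and for every x ∈ ℝ^{d-1} and y > 0, the filtered back-projection reconstruction formula holds: f(x, y) = (y^p / (2π)^{d-1}) · ∫_0^{π/2} cos(θ)^{-(1+p)} ∫_{S^{d-2}} g(x + y·tan(θ)·n, θ) dn dθ, where g(u, θ) := (2π)^{1-d} ∫_{ℝ^{d-1}} |k|^{d-1} (F R^(p) f)(k, θ) e^{i⟨k,u⟩} dk is the Riesz-filtered data. -/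
open MeasureTheory Real Metric
open scoped RealInnerProductSpace

noncomputable section

/-- The standard surface measure on the unit sphere `S^{d-2} ⊆ ℝ^{d-1}`
(for `d = 2` this is the counting measure on `S^0 = {±1}`). -/
def sphereMeasure (d : ℕ) : Measure (sphere (0 : EuclideanSpace ℝ (Fin (d - 1))) 1) :=
  (volume : Measure (EuclideanSpace ℝ (Fin (d - 1)))).toSphere

/-- The conical Radon transform with radial weight `1/s^p`:
`(R^(p) f)(u, θ) = ∫_0^∞ s^(-p) ∫_{S^{d-2}} f(u + s sin θ n, s cos θ) (s sin θ)^(d-2) dn ds`. -/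
def coneRadon (d : ℕ) (p : ℝ) (f : EuclideanSpace ℝ (Fin (d - 1)) × ℝ → ℝ)
    (u : EuclideanSpace ℝ (Fin (d - 1))) (θ : ℝ) : ℝ :=
  ∫ s in Set.Ioi (0 : ℝ),
    s ^ (-p) *
      ∫ n, f (u + (s * Real.sin θ) • (n : EuclideanSpace ℝ (Fin (d - 1))), s * Real.cos θ) *
          (s * Real.sin θ) ^ (d - 2) ∂(sphereMeasure d)

/-- Fourier transform in the first argument:
`(F g)(k, θ) = ∫_{ℝ^{d-1}} e^{-i⟨k,u⟩} g(u, θ) du`. -/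
def fourierFirst (d : ℕ) (g : EuclideanSpace ℝ (Fin (d - 1)) → ℝ → ℝ)
    (k : EuclideanSpace ℝ (Fin (d - 1))) (θ : ℝ) : ℂ :=
  ∫ u, Complex.exp (-Complex.I * (⟪k, u⟫ : ℝ)) * (g u θ : ℂ)

/-- The Riesz-filtered data
`g(u, θ) = (2π)^(1-d) ∫_{ℝ^{d-1}} |k|^(d-1) (F R^(p) f)(k, θ) e^{i⟨k,u⟩} dk`. -/
def filteredData (d : ℕ) (p : ℝ) (f : EuclideanSpace ℝ (Fin (d - 1)) × ℝ → ℝ)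
    (u : EuclideanSpace ℝ (Fin (d - 1))) (θ : ℝ) : ℂ :=
  (((2 * π) ^ ((1 : ℤ) - (d : ℤ)) : ℝ) : ℂ) *
    ∫ k, ((‖k‖ ^ (d - 1) : ℝ) : ℂ) * fourierFirst d (coneRadon d p f) k θ *
      Complex.exp (Complex.I * (⟪k, u⟫ : ℝ))

section Transform

variable {E : Type*} [NormedAddCommGroup E] [InnerProductSpace ℝ E] [FiniteDimensional ℝ E]
  [MeasurableSpace E] [BorelSpace E]

/-- The Fourier transform on `E × E` with kernel `exp (-i (⟪k, u⟫ + ⟪w, v⟫))`. -/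
def prodFourier (G : E × E → ℂ) (q : E × E) : ℂ :=
  ∫ z : E × E, Complex.exp (-Complex.I * ((⟪q.1, z.1⟫ + ⟪q.2, z.2⟫ : ℝ) : ℂ)) * G z

open scoped FourierTransform SchwartzMap in
theorem exists_schwartzMap_prodFourier {G : E × E → ℂ} (hG : ContDiff ℝ (⊤ : ℕ∞) G)
    (hGc : HasCompactSupport G) :
    ∃ S : 𝓢(WithLp 2 (E × E), ℂ), (∀ z, S (WithLp.toLp 2 z) = G z) ∧
      ∀ q, prodFourier G q = 𝓕 S ((2 * π)⁻¹ • WithLp.toLp 2 q) := by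
  have hL : ContDiff ℝ (⊤ : ℕ∞) (fun z : WithLp 2 (E × E) => z.ofLp) :=
    (WithLp.prodContinuousLinearEquiv 2 ℝ E E).contDiff
  have hc : HasCompactSupport (G ∘ (WithLp.prodContinuousLinearEquiv 2 ℝ E E)) :=
    hGc.comp_homeomorph (WithLp.prodContinuousLinearEquiv 2 ℝ E E).toHomeomorph
  refine ⟨hc.toSchwartzMap (hG.comp hL), fun z => rfl, fun q => ?_⟩
  rw [SchwartzMap.fourier_coe, Real.fourier_eq', prodFourier,
    ← (WithLp.volume_preserving_ofLp E E).integral_comp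
      (MeasurableEquiv.toLp 2 (E × E)).symm.measurableEmbedding]
  refine integral_congr_ae (.of_forall fun v => ?_)
  have h : -2 * π * ⟪v, (2 * π)⁻¹ • WithLp.toLp 2 q⟫ =
      -(⟪q.1, v.ofLp.1⟫ + ⟪q.2, v.ofLp.2⟫) := by
    rw [inner_smul_right, WithLp.prod_inner_apply]
    simp only [real_inner_comm]
    field_simp
  simp only [smul_eq_mul, h]
  congr 2
  push_cast
  ring

variable {G : E × E → ℂ} (hG : ContDiff ℝ (⊤ : ℕ∞) G) (hGc : HasCompactSupport G)
include hG hGc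

theorem continuous_prodFourier : Continuous (prodFourier G) := by
  obtain ⟨S, -, hS⟩ := exists_schwartzMap_prodFourier hG hGc
  rw [funext hS]
  have : Continuous fun q : E × E => WithLp.toLp 2 q :=
    (WithLp.prodContinuousLinearEquiv 2 ℝ E E).symm.continuous
  exact (SchwartzMap.continuous _).comp (this.const_smul (2 * π)⁻¹)

theorem integrable_prodFourier : Integrable (prodFourier G) := by
  obtain ⟨S, -, hS⟩ := exists_schwartzMap_prodFourier hG hGc
  rw [funext hS]
  have h := ((FourierTransform.fourier S).integrable (μ := volume)).comp_smul
    (inv_ne_zero two_pi_pos.ne')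
  exact (WithLp.volume_preserving_toLp E E).integrable_comp_of_integrable h

theorem integral_prodFourier (z : E × E) :
    ∫ q : E × E, prodFourier G q * Complex.exp (Complex.I * ((⟪q.1, z.1⟫ + ⟪q.2, z.2⟫ : ℝ) : ℂ)) =
      (2 * π) ^ (2 * Module.finrank ℝ E) * G z := by
  obtain ⟨S, hSG, hS⟩ := exists_schwartzMap_prodFourier hG hGc
  have inv : FourierTransform.fourierInv (FourierTransform.fourier S) (WithLp.toLp 2 z) = G z := by
    rw [FourierTransform.fourierInv_fourier_eq, hSG]
  rw [SchwartzMap.fourierInv_coe, Real.fourierInv_eq'] at inv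
  have hd : Module.finrank ℝ (WithLp 2 (E × E)) = 2 * Module.finrank ℝ E := by
    rw [(WithLp.linearEquiv 2 ℝ (E × E)).finrank_eq, Module.finrank_prod, two_mul]
  have key := Measure.integral_comp_inv_smul (volume : Measure (WithLp 2 (E × E)))
    (fun v => Complex.exp ((2 * π * ⟪v, WithLp.toLp 2 z⟫ : ℝ) * Complex.I) •
      FourierTransform.fourier S v) (2 * π)
  rw [inv, hd, abs_of_nonneg (by positivity), Complex.real_smul] at key
  push_cast at key
  rw [← key, ← (WithLp.volume_preserving_toLp E E).integral_comp
      (MeasurableEquiv.toLp 2 (E × E)).measurableEmbedding]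
  refine integral_congr_ae (.of_forall fun q => ?_)
  have h : 2 * π * ⟪(2 * π)⁻¹ • WithLp.toLp 2 q, WithLp.toLp 2 z⟫ =
      ⟪q.1, z.1⟫ + ⟪q.2, z.2⟫ := by
    rw [inner_smul_left, WithLp.prod_inner_apply]
    simp only [conj_trivial]
    field_simp
  simp only [hS, smul_eq_mul]
  rw [mul_comm, mul_comm Complex.I]
  congr 3
  rw [← h]
  push_cast
  rfl

omit hG hGc in
theorem prodFourier_isometry (L : E ≃ₗᵢ[ℝ] E) (hL : ∀ u v, G (u, L v) = G (u, v)) (k w : E) :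
    prodFourier G (k, L w) = prodFourier G (k, w) := by
  have hmp : MeasurePreserving (Prod.map id L : E × E → E × E) :=
    (MeasurePreserving.id volume).prod L.measurePreserving
  have hemb : MeasurableEmbedding (Prod.map id L : E × E → E × E) :=
    ((Homeomorph.refl E).prodCongr L.toHomeomorph).measurableEmbedding
  rw [prodFourier, ← hmp.integral_comp hemb]
  exact integral_congr_ae (.of_forall fun ⟨u, v⟩ => by simp [hL])

omit hG hGc in
theorem prodFourier_eq_of_norm_eq (hGr : ∀ u v v', ‖v‖ = ‖v'‖ → G (u, v) = G (u, v'))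
    (k : E) {w w' : E} (h : ‖w‖ = ‖w'‖) : prodFourier G (k, w) = prodFourier G (k, w') := by
  rw [← Submodule.reflection_sub h]
  exact (prodFourier_isometry _ (fun u v => hGr _ _ _ (by simp)) k w).symm

omit hG in
theorem integral_shear_eq_prodFourier (hG : Continuous G) (k : E) (r : ℝ) :
    ∫ u, Complex.exp (-Complex.I * (⟪k, u⟫ : ℝ)) * ∫ v, G (u + r • v, v) =
      prodFourier G (k, -(r • k)) := by
  have hshear : HasCompactSupport fun z : E × E => G (z.1 + r • z.2, z.2) := by
    let e : E × E ≃ₜ E × E :=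
      { toFun z := (z.1 + r • z.2, z.2)
        invFun z := (z.1 - r • z.2, z.2)
        left_inv z := by simp
        right_inv z := by simp
        continuous_toFun := by fun_prop
        continuous_invFun := by fun_prop }
    exact hGc.comp_homeomorph e
  have hint : Integrable (fun z : E × E =>
      Complex.exp (-Complex.I * (⟪k, z.1⟫ : ℝ)) * G (z.1 + r • z.2, z.2)) := by
    refine Continuous.integrable_of_hasCompactSupport (by fun_prop) hshear.mul_left
  have hint' : Integrable (fun z : E × E =>
      Complex.exp (-Complex.I * ((⟪k, z.1⟫ + ⟪-(r • k), z.2⟫ : ℝ) : ℂ)) * G z) :=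
    Continuous.integrable_of_hasCompactSupport (by fun_prop) hGc.mul_left
  simp_rw [← integral_const_mul]
  rw [integral_integral_swap hint, prodFourier, Measure.volume_eq_prod,
    integral_prod_symm _ hint']
  refine integral_congr_ae (.of_forall fun v => ?_)
  dsimp only
  rw [← integral_add_right_eq_self (fun u => Complex.exp
    (-Complex.I * ((⟪k, u⟫ + ⟪-(r • k), v⟫ : ℝ) : ℂ)) * G (u, v)) (r • v)]
  refine integral_congr_ae (.of_forall fun u => ?_)
  simp [inner_add_right, inner_smul_left, inner_smul_right]

end Transform

section Polar

variable {E : Type*} [NormedAddCommGroup E] [NormedSpace ℝ E] [FiniteDimensional ℝ E]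
  [MeasurableSpace E] [BorelSpace E] [Nontrivial E] (μ : Measure E) [μ.IsAddHaarMeasure]

/-- Integration in polar coordinates. -/
theorem integral_eq_integral_Ioi_integral_sphere {F : Type*} [NormedAddCommGroup F]
    [NormedSpace ℝ F] {g : E → F} (hg : Integrable g μ) :
    ∫ x, g x ∂μ = ∫ r in Set.Ioi (0 : ℝ), r ^ (Module.finrank ℝ E - 1) •
      ∫ n : sphere (0 : E) 1, g (r • (n : E)) ∂μ.toSphere := by
  have hmp := μ.measurePreserving_homeomorphUnitSphereProd
  have hemb := (homeomorphUnitSphereProd E).symm.measurableEmbedding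
  have hmp' := hmp.symm (homeomorphUnitSphereProd E).toMeasurableEquiv
  have hg' : Integrable (fun z : ({(0)}ᶜ : Set E) => g z) (μ.comap (↑)) := by
    have := integrableOn_iff_comap_subtypeVal (μ := μ) (f := g)
      (measurableSet_singleton (0 : E)).compl
    exact this.1 hg.integrableOn
  have hg2 : Integrable (fun z : sphere (0 : E) 1 × Set.Ioi (0 : ℝ) => g ((z.2 : ℝ) • (z.1 : E)))
      (μ.toSphere.prod (.volumeIoiPow (Module.finrank ℝ E - 1))) :=
    hmp'.integrable_comp_of_integrable hg'
  calc
    ∫ x, g x ∂μ = ∫ x : ({(0)}ᶜ : Set E), g x ∂(μ.comap (↑)) := by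
      rw [integral_subtype_comap (measurableSet_singleton _).compl g,
        restrict_compl_singleton]
    _ = ∫ z : sphere (0 : E) 1 × Set.Ioi (0 : ℝ), g ((z.2 : ℝ) • (z.1 : E))
          ∂μ.toSphere.prod (.volumeIoiPow (Module.finrank ℝ E - 1)) :=
      (hmp'.integral_comp hemb fun z : ({(0)}ᶜ : Set E) => g z).symm
    _ = ∫ r : Set.Ioi (0 : ℝ), ∫ n : sphere (0 : E) 1, g ((r : ℝ) • (n : E)) ∂μ.toSphere
          ∂.volumeIoiPow (Module.finrank ℝ E - 1) := integral_prod_symm _ hg2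
    _ = _ := by
      simp only [Measure.volumeIoiPow, ENNReal.ofReal]
      rw [integral_withDensity_eq_integral_smul,
        integral_subtype_comap measurableSet_Ioi fun a : ℝ =>
          Real.toNNReal (a ^ (Module.finrank ℝ E - 1)) •
            ∫ n : sphere (0 : E) 1, g (a • (n : E)) ∂μ.toSphere,
        setIntegral_congr_fun measurableSet_Ioi fun x hx => ?_]
      · rw [NNReal.smul_def, Real.coe_toNNReal _ (pow_nonneg (le_of_lt hx) _)]
      · exact (measurable_subtype_coe.pow_const _).real_toNNReal

end Polar

section Lift

variable {E : Type*} [NormedAddCommGroup E] [InnerProductSpace ℝ E] {f : E × ℝ → ℝ}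

/-- The function `(u, v) ↦ ‖v‖ ^ (-p) f (u, ‖v‖)` on `E × E`. -/
def radialLift (p : ℝ) (f : E × ℝ → ℝ) (z : E × E) : ℝ :=
  ‖z.2‖ ^ (-p) * f (z.1, ‖z.2‖)

theorem contDiff_radialLift (p : ℝ) (hf : ContDiff ℝ (⊤ : ℕ∞) f)
    (hfs : tsupport f ⊆ {q : E × ℝ | 0 < q.2}) :
    ContDiff ℝ (⊤ : ℕ∞) (radialLift p f) := by
  refine contDiff_iff_contDiffAt.2 fun z => ?_
  by_cases hz : z.2 = 0
  · have h0 : (z.1, ‖z.2‖) ∉ tsupport f := fun h => by simpa [hz] using hfs h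
    have hc : Continuous fun z : E × E => (z.1, ‖z.2‖) := by fun_prop
    have h1 : ∀ᶠ z' in nhds z, (z'.1, ‖z'.2‖) ∉ tsupport f :=
      hc.continuousAt.eventually ((isClosed_tsupport f).isOpen_compl.mem_nhds h0)
    refine (contDiffAt_const (c := (0 : ℝ))).congr_of_eventuallyEq ?_
    filter_upwards [h1] with z' hz'
    simp [radialLift, image_eq_zero_of_notMem_tsupport hz']
  · have hn : ContDiffAt ℝ (⊤ : ℕ∞) (fun z : E × E => ‖z.2‖) z := contDiffAt_snd.norm ℝ hz
    exact (hn.rpow_const_of_ne (norm_ne_zero_iff.2 hz)).mul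
      (hf.contDiffAt.comp z (contDiffAt_fst.prodMk hn))

theorem hasCompactSupport_radialLift [FiniteDimensional ℝ E] (p : ℝ)
    (hfc : HasCompactSupport f) : HasCompactSupport (radialLift p f) := by
  have hK : IsCompact (((fun q : E × ℝ => q.1) '' tsupport f) ×ˢ
      closedBall (0 : E) (sSup ((fun q : E × ℝ => q.2) '' tsupport f))) :=
    (hfc.isCompact.image continuous_fst).prod (isCompact_closedBall _ _)
  refine HasCompactSupport.intro hK fun z hz => ?_
  have : (z.1, ‖z.2‖) ∉ tsupport f := fun h => hz ⟨⟨_, h, rfl⟩, by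
    rw [mem_closedBall_zero_iff]
    exact le_csSup (hfc.isCompact.image continuous_snd).bddAbove ⟨_, h, rfl⟩⟩
  simp [radialLift, image_eq_zero_of_notMem_tsupport this]

end Lift

section BackProjection

variable {E : Type*} [NormedAddCommGroup E] [InnerProductSpace ℝ E] [FiniteDimensional ℝ E]
  [MeasurableSpace E] [BorelSpace E] {F : Type*} [NormedAddCommGroup F]

theorem integral_comp_smul_isometry [NormedSpace ℝ F] (g : E → F) (c : ℝ) (L : E ≃ₗᵢ[ℝ] E) :
    ∫ w, g (c • L w) = |(c ^ Module.finrank ℝ E)⁻¹| • ∫ w, g w := by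
  rw [L.measurePreserving.integral_comp L.toHomeomorph.measurableEmbedding fun w => g (c • w),
    Measure.integral_comp_smul]

theorem integrable_comp_smul_isometry {g : E → F} (hg : Integrable g) {c : ℝ} (hc : c ≠ 0)
    (L : E ≃ₗᵢ[ℝ] E) : Integrable fun w => g (c • L w) :=
  L.measurePreserving.integrable_comp_of_integrable (hg.comp_smul hc)

/-- The kernel of the back-projection operator after passing to polar coordinates. -/
def backProjectionKernel (A : E × E → ℂ) (x : E) (y : ℝ) (z : E × E) : ℂ :=
  ((‖z.2‖ ^ Module.finrank ℝ E : ℝ) : ℂ) * A (z.2, ‖z.1‖ • z.2) *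
    Complex.exp (Complex.I * (⟪z.2, x + y • z.1⟫ : ℝ))

variable {A : E × E → ℂ} (hAr : ∀ k w w', ‖w‖ = ‖w'‖ → A (k, w) = A (k, w'))
  (x : E) (y : ℝ) {e : E} (he : ‖e‖ = 1)

omit [FiniteDimensional ℝ E] [MeasurableSpace E] [BorelSpace E] in
include hAr he in
theorem exists_isometry_backProjectionKernel_eq {k : E} (hk : k ≠ 0) :
    ∃ L : E ≃ₗᵢ[ℝ] E, ∀ w, backProjectionKernel A x y (w, k) =
      ((‖k‖ ^ Module.finrank ℝ E : ℝ) : ℂ) * (fun w' => A (k, w') *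
        Complex.exp (Complex.I * ((⟪k, x⟫ + ⟪w', y • e⟫ : ℝ) : ℂ))) (‖k‖ • L w) := by
  have hk' : ‖k‖ ≠ 0 := norm_ne_zero_iff.2 hk
  have hn : ‖‖k‖⁻¹ • k‖ = ‖e‖ := by
    rw [norm_smul, norm_inv, norm_norm, inv_mul_cancel₀ hk', he]
  refine ⟨Submodule.reflection (ℝ ∙ (‖k‖⁻¹ • k - e))ᗮ, fun w => ?_⟩
  set L := Submodule.reflection (ℝ ∙ (‖k‖⁻¹ • k - e))ᗮ with hL
  have hLe : L (‖k‖⁻¹ • k) = e := Submodule.reflection_sub hn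
  have h1 : A (k, ‖w‖ • k) = A (k, ‖k‖ • L w) := hAr _ _ _ (by simp [norm_smul, mul_comm])
  have h2 : ⟪k, x + y • w⟫ = ⟪k, x⟫ + ⟪‖k‖ • L w, y • e⟫ := by
    rw [← hLe, inner_add_right, inner_smul_right, inner_smul_left, inner_smul_right,
      L.inner_map_map, inner_smul_right, real_inner_comm k w]
    simp only [conj_trivial]
    field_simp
  simp only [backProjectionKernel, h1, h2, mul_assoc]

include hAr he in
theorem integral_backProjectionKernel_left {k : E} (hk : k ≠ 0) :
    ∫ w, backProjectionKernel A x y (w, k) =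
      ∫ w, A (k, w) * Complex.exp (Complex.I * ((⟪k, x⟫ + ⟪w, y • e⟫ : ℝ) : ℂ)) := by
  obtain ⟨L, hL⟩ := exists_isometry_backProjectionKernel_eq hAr x y he hk
  have hk' : ‖k‖ ^ Module.finrank ℝ E ≠ 0 := pow_ne_zero _ (norm_ne_zero_iff.2 hk)
  simp_rw [hL]
  rw [integral_const_mul, integral_comp_smul_isometry (fun w' => A (k, w') *
      Complex.exp (Complex.I * ((⟪k, x⟫ + ⟪w', y • e⟫ : ℝ) : ℂ))),
    abs_of_nonneg (by positivity), Complex.real_smul, ← mul_assoc, ← Complex.ofReal_mul, mul_inv_cancel₀ hk', Complex.ofReal_one,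
    one_mul]

include hAr he in
theorem integral_norm_backProjectionKernel_left {k : E} (hk : k ≠ 0) :
    ∫ w, ‖backProjectionKernel A x y (w, k)‖ = ∫ w, ‖A (k, w)‖ := by
  obtain ⟨L, hL⟩ := exists_isometry_backProjectionKernel_eq hAr x y he hk
  have hk' : ‖k‖ ^ Module.finrank ℝ E ≠ 0 := pow_ne_zero _ (norm_ne_zero_iff.2 hk)
  have h : ∀ w, ‖backProjectionKernel A x y (w, k)‖ =
      ‖k‖ ^ Module.finrank ℝ E * (fun w' => ‖A (k, w')‖) (‖k‖ • L w) := fun w => by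
    rw [hL, norm_mul, norm_mul, Complex.norm_real, mul_comm Complex.I,
      Complex.norm_exp_ofReal_mul_I, mul_one, norm_pow, norm_norm]
  simp_rw [h]
  rw [integral_const_mul, integral_comp_smul_isometry (fun w' => ‖A (k, w')‖),
    abs_of_nonneg (by positivity), smul_eq_mul, ← mul_assoc, mul_inv_cancel₀ hk', one_mul]

theorem Integrable.mul_cexp_I {α : Type*} [MeasurableSpace α] {μ : Measure α} {g : α → ℂ}
    (hg : Integrable g μ) {φ : α → ℝ} (hφ : AEStronglyMeasurable φ μ) :
    Integrable (fun a => g a * Complex.exp (Complex.I * φ a)) μ := by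
  refine hg.mul_bdd (c := 1) ?_ (.of_forall fun a => ?_)
  · exact Complex.continuous_exp.comp_aestronglyMeasurable
      ((Complex.continuous_ofReal.comp_aestronglyMeasurable hφ).const_mul _)
  · rw [mul_comm Complex.I, Complex.norm_exp_ofReal_mul_I]

variable [Nontrivial E] (hA : Continuous A) (hAi : Integrable A)

include hAr he hA hAi in
theorem integrable_backProjectionKernel : Integrable (backProjectionKernel A x y) := by
  have hc : Continuous (backProjectionKernel A x y) := by
    unfold backProjectionKernel
    fun_prop
  have hne : ∀ᵐ k : E, k ≠ 0 := Measure.ae_ne volume 0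
  rw [Measure.volume_eq_prod] at hAi ⊢
  rw [integrable_prod_iff' hc.aestronglyMeasurable]
  constructor
  · filter_upwards [hne, hAi.prod_right_ae] with k hk hki
    obtain ⟨L, hL⟩ := exists_isometry_backProjectionKernel_eq hAr x y he hk
    simp_rw [hL]
    have hi : Integrable fun w' => A (k, w') *
        Complex.exp (Complex.I * ((⟪k, x⟫ + ⟪w', y • e⟫ : ℝ) : ℂ)) :=
      Integrable.mul_cexp_I hki (by fun_prop)
    exact (integrable_comp_smul_isometry hi (norm_ne_zero_iff.2 hk) L).const_mul _
  · refine hAi.norm.integral_prod_left.congr ?_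
    filter_upwards [hne] with k hk
    exact (integral_norm_backProjectionKernel_left hAr x y he hk).symm

include hAr he hA hAi in
theorem integral_backProjectionKernel :
    ∫ w, ∫ k, backProjectionKernel A x y (w, k) =
      ∫ q : E × E, A q * Complex.exp (Complex.I * ((⟪q.1, x⟫ + ⟪q.2, y • e⟫ : ℝ) : ℂ)) := by
  have hne : ∀ᵐ k : E, k ≠ 0 := Measure.ae_ne volume 0
  have hi := integrable_backProjectionKernel hAr x y he hA hAi
  rw [Measure.volume_eq_prod] at hi
  rw [integral_integral_swap (f := fun w k => backProjectionKernel A x y (w, k)) hi,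
    Measure.volume_eq_prod, integral_prod]
  · refine integral_congr_ae ?_
    filter_upwards [hne] with k hk
    exact integral_backProjectionKernel_left hAr x y he hk
  · exact Integrable.mul_cexp_I hAi (by fun_prop)

end BackProjection

section ConeRadon

variable {d : ℕ} {p : ℝ} {f : EuclideanSpace ℝ (Fin (d - 1)) × ℝ → ℝ}

theorem coneRadon_eq_integral_radialLift (hd : 2 ≤ d) (hf : ContDiff ℝ (⊤ : ℕ∞) f)
    (hfc : HasCompactSupport f)
    (hfs : tsupport f ⊆ {q : EuclideanSpace ℝ (Fin (d - 1)) × ℝ | 0 < q.2})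
    (u : EuclideanSpace ℝ (Fin (d - 1))) {θ : ℝ} (hθ : θ ∈ Set.Ioo 0 (π / 2)) :
    coneRadon d p f u θ = Real.cos θ ^ (p - 1) * Real.tan θ ^ (d - 2) *
      ∫ v, radialLift p f (u + Real.tan θ • v, v) := by
  have : Nontrivial (EuclideanSpace ℝ (Fin (d - 1))) := by
    have : Nonempty (Fin (d - 1)) := ⟨⟨0, by omega⟩⟩
    infer_instance
  have hcos : 0 < Real.cos θ := Real.cos_pos_of_mem_Ioo ⟨by linarith [hθ.1, pi_pos], hθ.2⟩
  have hint : Integrable fun v : EuclideanSpace ℝ (Fin (d - 1)) =>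
      radialLift p f (u + Real.tan θ • v, v) := by
    have hG := (contDiff_radialLift p hf hfs).continuous
    refine Continuous.integrable_of_hasCompactSupport (by fun_prop) ?_
    refine HasCompactSupport.intro
      ((hasCompactSupport_radialLift p hfc).isCompact.image continuous_snd) fun v hv => ?_
    exact image_eq_zero_of_notMem_tsupport fun h => hv ⟨_, h, rfl⟩
  rw [integral_eq_integral_Ioi_integral_sphere _ hint, ← integral_const_mul, coneRadon]
  have hscale := integral_comp_mul_left_Ioi' (fun s : ℝ => s ^ (-p) * ∫ n, f (u + (s * Real.sin θ) •
    (n : EuclideanSpace ℝ (Fin (d - 1))), s * Real.cos θ) * (s * Real.sin θ) ^ (d - 2)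
      ∂(sphereMeasure d)) 0 (inv_pos.2 hcos)
  rw [mul_zero] at hscale
  rw [← hscale, ← integral_smul]
  refine setIntegral_congr_fun measurableSet_Ioi fun t ht => ?_
  have ht : 0 < t := ht
  have hfr : Module.finrank ℝ (EuclideanSpace ℝ (Fin (d - 1))) - 1 = d - 2 := by
    rw [finrank_euclideanSpace_fin]; omega
  have h1 : (Real.cos θ)⁻¹ * t * Real.sin θ = t * Real.tan θ := by
    rw [Real.tan_eq_sin_div_cos]; ring
  have h2 : (Real.cos θ)⁻¹ * t * Real.cos θ = t := by field_simp
  have h3 : ∀ n : sphere (0 : EuclideanSpace ℝ (Fin (d - 1))) 1,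
      radialLift p f (u + Real.tan θ • t • (n : EuclideanSpace ℝ (Fin (d - 1))), t • n) =
        t ^ (-p) * f (u + (t * Real.tan θ) • (n : EuclideanSpace ℝ (Fin (d - 1))), t) := fun n => by
    have : ‖t • (n : EuclideanSpace ℝ (Fin (d - 1)))‖ = t := by
      rw [norm_smul, norm_eq_of_mem_sphere, mul_one, Real.norm_of_nonneg ht.le]
    simp only [radialLift, this, smul_smul, mul_comm t]
  have h4 : (Real.cos θ)⁻¹ * ((Real.cos θ)⁻¹ * t) ^ (-p) = Real.cos θ ^ (p - 1) * t ^ (-p) := by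
    rw [Real.mul_rpow (by positivity) ht.le, Real.inv_rpow hcos.le, Real.rpow_neg hcos.le, inv_inv,
      Real.rpow_sub_one hcos.ne']
    ring
  simp only [h1, h2, h3, hfr, smul_eq_mul, sphereMeasure]
  rw [integral_mul_const, integral_const_mul, ← mul_assoc, h4, mul_pow]
  ring

theorem fourierFirst_coneRadon (hd : 2 ≤ d) (hf : ContDiff ℝ (⊤ : ℕ∞) f)
    (hfc : HasCompactSupport f)
    (hfs : tsupport f ⊆ {q : EuclideanSpace ℝ (Fin (d - 1)) × ℝ | 0 < q.2})
    (k : EuclideanSpace ℝ (Fin (d - 1))) {θ : ℝ} (hθ : θ ∈ Set.Ioo 0 (π / 2)) :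
    fourierFirst d (coneRadon d p f) k θ =
      ((Real.cos θ ^ (p - 1) * Real.tan θ ^ (d - 2) : ℝ) : ℂ) *
        prodFourier (fun z => (radialLift p f z : ℂ)) (k, Real.tan θ • k) := by
  have hc : Continuous fun z => (radialLift p f z : ℂ) :=
    Complex.continuous_ofReal.comp (contDiff_radialLift p hf hfs).continuous
  have hs : HasCompactSupport fun z => (radialLift p f z : ℂ) :=
    (hasCompactSupport_radialLift p hfc).comp_left Complex.ofReal_zero
  rw [prodFourier_eq_of_norm_eq (fun u v v' h => by simp only [radialLift, h]) k
      (norm_neg (Real.tan θ • k)).symm, ← integral_shear_eq_prodFourier hs hc,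
    ← integral_const_mul, fourierFirst]
  refine integral_congr_ae (.of_forall fun u => ?_)
  simp only [coneRadon_eq_integral_radialLift hd hf hfc hfs u hθ]
  rw [Complex.ofReal_mul, ← integral_complex_ofReal]
  ring

theorem filteredData_eq (hd : 2 ≤ d) (hf : ContDiff ℝ (⊤ : ℕ∞) f)
    (hfc : HasCompactSupport f)
    (hfs : tsupport f ⊆ {q : EuclideanSpace ℝ (Fin (d - 1)) × ℝ | 0 < q.2})
    (x n : EuclideanSpace ℝ (Fin (d - 1))) (hn : ‖n‖ = 1) (y : ℝ) {θ : ℝ}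
    (hθ : θ ∈ Set.Ioo 0 (π / 2)) :
    filteredData d p f (x + (y * Real.tan θ) • n) θ =
      (((2 * π) ^ ((1 : ℤ) - (d : ℤ)) * (Real.cos θ ^ (p - 1) * Real.tan θ ^ (d - 2)) : ℝ) : ℂ) *
        ∫ k, backProjectionKernel (prodFourier fun z => (radialLift p f z : ℂ)) x y
          (Real.tan θ • n, k) := by
  have htan : 0 ≤ Real.tan θ := Real.tan_nonneg_of_nonneg_of_le_pi_div_two hθ.1.le hθ.2.le
  rw [filteredData, Complex.ofReal_mul, mul_assoc]
  congr 1
  rw [← integral_const_mul]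
  refine integral_congr_ae (.of_forall fun k => ?_)
  simp only [fourierFirst_coneRadon hd hf hfc hfs k hθ, backProjectionKernel, norm_smul, hn,
    Real.norm_of_nonneg htan, mul_one, finrank_euclideanSpace_fin, smul_smul]
  ring

end ConeRadon

theorem tan_image_Ioo_zero : Real.tan '' Set.Ioo 0 (π / 2) = Set.Ioi 0 := by
  ext r
  constructor
  · rintro ⟨θ, hθ, rfl⟩
    exact Real.tan_pos_of_pos_of_lt_pi_div_two hθ.1 hθ.2
  · intro hr
    exact ⟨arctan r, ⟨arctan_pos.2 hr, arctan_lt_pi_div_two r⟩, tan_arctan r⟩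

theorem integral_Ioi_eq_integral_tan {F : Type*} [NormedAddCommGroup F] [NormedSpace ℝ F]
    (g : ℝ → F) : ∫ r in Set.Ioi (0 : ℝ), g r =
      ∫ θ in Set.Ioo (0 : ℝ) (π / 2), (1 / Real.cos θ ^ 2) • g (Real.tan θ) := by
  have hsub : Set.Ioo 0 (π / 2) ⊆ Set.Ioo (-(π / 2)) (π / 2) :=
    Set.Ioo_subset_Ioo_left (by linarith [pi_pos])
  rw [← tan_image_Ioo_zero, integral_image_eq_integral_abs_deriv_smul measurableSet_Ioo
    (fun θ hθ => (hasDerivAt_tan (cos_pos_of_mem_Ioo (hsub hθ)).ne').hasDerivWithinAt)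
    (injOn_tan.mono hsub)]
  simp_rw [abs_of_nonneg (one_div_nonneg.2 (sq_nonneg (Real.cos _)))]

/-- filtered back-projection reconstruction, angle parametrization:
for smooth `f` compactly supported in `ℝ^{d-1} × (0,∞)` and `y > 0`,
`f(x,y) = (y^p/(2π)^{d-1}) ∫_0^{π/2} cos θ^{-(1+p)} ∫_{S^{d-2}} g(x + y tan θ n, θ) dn dθ`
where `g` is the Riesz-filtered data. -/
theorem coneRadon_fbp_angle (d : ℕ) (hd : 2 ≤ d) (p : ℝ)
    (f : EuclideanSpace ℝ (Fin (d - 1)) × ℝ → ℝ)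
    (hf : ContDiff ℝ (⊤ : ℕ∞) f) (hfc : HasCompactSupport f)
    (hfs : tsupport f ⊆ {q : EuclideanSpace ℝ (Fin (d - 1)) × ℝ | 0 < q.2})
    (x : EuclideanSpace ℝ (Fin (d - 1))) (y : ℝ) (hy : 0 < y) :
    (f (x, y) : ℂ) =
      ((y ^ p / (2 * π) ^ (d - 1) : ℝ) : ℂ) *
        ∫ θ in Set.Ioo (0 : ℝ) (π / 2),
          ((Real.cos θ ^ (-(1 + p)) : ℝ) : ℂ) *
            ∫ n, filteredData d p f
                (x + (y * Real.tan θ) • (n : EuclideanSpace ℝ (Fin (d - 1)))) θ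
              ∂(sphereMeasure d) := by
  have : Nontrivial (EuclideanSpace ℝ (Fin (d - 1))) := by
    have : Nonempty (Fin (d - 1)) := ⟨⟨0, by omega⟩⟩
    infer_instance
  obtain ⟨e, he⟩ := exists_norm_eq (EuclideanSpace ℝ (Fin (d - 1))) zero_le_one
  have hG : ContDiff ℝ (⊤ : ℕ∞) fun z => (radialLift p f z : ℂ) :=
    Complex.ofRealCLM.contDiff.comp (contDiff_radialLift p hf hfs)
  have hs : HasCompactSupport fun z => (radialLift p f z : ℂ) :=
    (hasCompactSupport_radialLift p hfc).comp_left Complex.ofReal_zero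
  have hAr : ∀ k w w', ‖w‖ = ‖w'‖ → prodFourier (fun z => (radialLift p f z : ℂ)) (k, w) =
      prodFourier (fun z => (radialLift p f z : ℂ)) (k, w') := fun k w w' h =>
    prodFourier_eq_of_norm_eq (fun u v v' h => by simp only [radialLift, h]) k h
  have hA := continuous_prodFourier hG hs
  have hAi := integrable_prodFourier hG hs
  have hB := integrable_backProjectionKernel hAr x y he hA hAi
  rw [Measure.volume_eq_prod] at hB
  have key := integral_backProjectionKernel hAr x y he hA hAi
  rw [integral_eq_integral_Ioi_integral_sphere _ hB.integral_prod_left,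
    integral_prodFourier hG hs (x, y • e), integral_Ioi_eq_integral_tan,
    finrank_euclideanSpace_fin] at key
  have hlift : radialLift p f (x, y • e) = y ^ (-p) * f (x, y) := by
    simp only [radialLift, norm_smul, he, Real.norm_of_nonneg hy.le, mul_one]
  have hθint : ∀ θ ∈ Set.Ioo (0 : ℝ) (π / 2),
      ((Real.cos θ ^ (-(1 + p)) : ℝ) : ℂ) *
          ∫ n, filteredData d p f
            (x + (y * Real.tan θ) • (n : EuclideanSpace ℝ (Fin (d - 1)))) θ ∂(sphereMeasure d) =
        (((2 * π) ^ ((1 : ℤ) - (d : ℤ)) : ℝ) : ℂ) * ((1 / Real.cos θ ^ 2) •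
          (Real.tan θ ^ (d - 1 - 1) • ∫ n : sphere (0 : EuclideanSpace ℝ (Fin (d - 1))) 1,
            (∫ k, backProjectionKernel (prodFourier fun z => (radialLift p f z : ℂ)) x y
              (Real.tan θ • (n : EuclideanSpace ℝ (Fin (d - 1))), k)) ∂volume.toSphere)) := by
    intro θ hθ
    have hcos : 0 < Real.cos θ := Real.cos_pos_of_mem_Ioo ⟨by linarith [hθ.1, pi_pos], hθ.2⟩
    have hc : Real.cos θ ^ (-(1 + p)) * Real.cos θ ^ (p - 1) = 1 / Real.cos θ ^ 2 := by
      rw [← Real.rpow_add hcos, one_div, ← Real.rpow_natCast, ← Real.rpow_neg hcos.le]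
      congr 1
      push_cast
      ring
    simp_rw [fun n : sphere (0 : EuclideanSpace ℝ (Fin (d - 1))) 1 =>
      filteredData_eq (p := p) hd hf hfc hfs x n (norm_eq_of_mem_sphere n) y hθ]
    rw [integral_const_mul, ← hc, sphereMeasure, Complex.real_smul, Complex.real_smul]
    push_cast
    rw [show d - 1 - 1 = d - 2 by omega]
    ring
  rw [setIntegral_congr_fun measurableSet_Ioo hθint, integral_const_mul, key, hlift]
  have hz : (2 * π) ^ ((1 : ℤ) - (d : ℤ)) = ((2 * π) ^ (d - 1))⁻¹ := by
    rw [← zpow_natCast, ← zpow_neg]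
    congr 1
    omega
  have hyp : y ^ p * y ^ (-p) = 1 := by
    rw [← Real.rpow_add hy, add_neg_cancel, Real.rpow_zero]
  have hfin : f (x, y) = y ^ p / (2 * π) ^ (d - 1) * (((2 * π) ^ (d - 1))⁻¹ *
      ((2 * π) ^ (2 * (d - 1)) * (y ^ (-p) * f (x, y)))) := by
    rw [two_mul (d - 1), pow_add]
    calc f (x, y) = y ^ p * y ^ (-p) * f (x, y) := by rw [hyp, one_mul]
      _ = _ := by field_simp
  rw [hz]
  exact_mod_cast hfin
end
end

section
/- Let p ∈ ℝ and let f : ℝ × ℝ → ℝ be smooth with compact support contained in ℝ × (0,∞). For every x ∈ ℝ and y > 0: f(x, y) = (y^p / (2π)) · ∫_0^{π/2} cos(θ)^{-(1+p)} · [g(x + y·tan(θ), θ) + g(x − y·tan(θ), θ)] dθ, where g(u, θ) := (1/(2π)) ∫_ℝ |k| (F R^(p) f)(k, θ) e^{iku} dk is the filtered data (equal to ∂_u H_u R^(p) f, the derivative of the Hilbert transform in the first argument). -/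
open MeasureTheory Real

noncomputable section

/-- The two-dimensional conical Radon transform with radial weight `1/s^p`:
`(R^(p) f)(u, θ) = ∫_0^∞ s^(-p) [f(u + s sin θ, s cos θ) + f(u - s sin θ, s cos θ)] ds`. -/
def coneRadon2 (p : ℝ) (f : ℝ × ℝ → ℝ) (u θ : ℝ) : ℝ :=
  ∫ s in Set.Ioi (0 : ℝ),
    s ^ (-p) *
      (f (u + s * Real.sin θ, s * Real.cos θ) + f (u - s * Real.sin θ, s * Real.cos θ))

/-- Fourier transform in the first argument: `(F g)(k, θ) = ∫_ℝ e^{-iku} g(u, θ) du`. -/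
def fourierFirst2 (g : ℝ → ℝ → ℝ) (k θ : ℝ) : ℂ :=
  ∫ u : ℝ, Complex.exp (-Complex.I * (k * u : ℝ)) * (g u θ : ℂ)

/-- The filtered data `g(u, θ) = (1/(2π)) ∫_ℝ |k| (F R^(p) f)(k, θ) e^{iku} dk`
(equal to `∂_u H_u R^(p) f`). -/
def filteredData2 (p : ℝ) (f : ℝ × ℝ → ℝ) (u θ : ℝ) : ℂ :=
  ((1 / (2 * π) : ℝ) : ℂ) *
    ∫ k : ℝ, ((|k| : ℝ) : ℂ) * fourierFirst2 (coneRadon2 p f) k θ *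
      Complex.exp (Complex.I * (k * u : ℝ))

theorem integral_shear {Ψ : ℝ × ℝ → ℂ} (hc : Continuous Ψ) (hs : HasCompactSupport Ψ) (t : ℝ) :
    Integrable (fun q : ℝ × ℝ => Ψ (q.1 + q.2 * t, q.2)) ∧
      ∫ q : ℝ × ℝ, Ψ (q.1 + q.2 * t, q.2) = ∫ q, Ψ q := by
  let e : ℝ × ℝ ≃ₜ ℝ × ℝ :=
    { toFun := fun q => (q.1 + q.2 * t, q.2)
      invFun := fun q => (q.1 - q.2 * t, q.2)
      left_inv := fun q => by simp
      right_inv := fun q => by simp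
      continuous_toFun := by fun_prop
      continuous_invFun := by fun_prop }
  have hi : Integrable (fun q : ℝ × ℝ => Ψ (q.1 + q.2 * t, q.2)) :=
    (hc.comp e.continuous).integrable_of_hasCompactSupport (hs.comp_homeomorph e)
  refine ⟨hi, ?_⟩
  have hi' : Integrable Ψ := hc.integrable_of_hasCompactSupport hs
  rw [Measure.volume_eq_prod] at hi hi' ⊢
  rw [integral_prod_symm _ hi, integral_prod_symm _ hi']
  congr 1
  ext z
  exact integral_add_right_eq_self (fun v => Ψ (v, z)) (z * t)

theorem integral_abs_mul_dilate {Φ : ℝ × ℝ → ℂ} (hc : Continuous Φ) (hi : Integrable Φ) :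
    Integrable (fun q : ℝ × ℝ => ((|q.1| : ℝ) : ℂ) * Φ (q.1, q.1 * q.2)) ∧
      ∫ t : ℝ, ∫ k : ℝ, ((|k| : ℝ) : ℂ) * Φ (k, k * t) = ∫ q, Φ q := by
  have hne : ∀ᵐ k : ℝ, k ≠ 0 := by simp [ae_iff]
  rw [Measure.volume_eq_prod] at hi
  have hi₁ := (integrable_prod_iff hi.aestronglyMeasurable).1 hi
  have hint : Integrable (fun q : ℝ × ℝ => ((|q.1| : ℝ) : ℂ) * Φ (q.1, q.1 * q.2)) := by
    rw [Measure.volume_eq_prod, integrable_prod_iff (by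
      apply Continuous.aestronglyMeasurable; fun_prop)]
    refine ⟨?_, hi₁.2.congr ?_⟩
    · filter_upwards [hi₁.1, hne] with k hk hk0
      exact (hk.comp_mul_left' hk0).const_mul _
    · filter_upwards [hne] with k hk0
      simp only [norm_mul, Complex.norm_real, norm_eq_abs, abs_abs]
      rw [integral_const_mul, Measure.integral_comp_mul_left (fun l => ‖Φ (k, l)‖) k, abs_inv,
        smul_eq_mul, mul_inv_cancel_left₀ (abs_ne_zero.2 hk0)]
  refine ⟨hint, ?_⟩
  rw [← integral_integral_swap (f := fun k t => ((|k| : ℝ) : ℂ) * Φ (k, k * t)) hint,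
    Measure.volume_eq_prod, integral_prod _ hi]
  refine integral_congr_ae ?_
  filter_upwards [hne] with k hk0
  rw [integral_const_mul, Measure.integral_comp_mul_left (fun l => Φ (k, l)) k, abs_inv,
    Complex.real_smul, Complex.ofReal_inv, mul_inv_cancel_left₀ (by simpa using hk0)]

theorem integrable_equivRealProd {g : ℂ → ℂ} (hg : Integrable g) :
    Integrable (fun q : ℝ × ℝ => g ⟨q.1, q.2⟩) :=
  (Complex.volume_preserving_equiv_real_prod.symm.integrable_comp_emb
    (MeasurableEquiv.measurableEmbedding _)).2 hg

theorem integral_equivRealProd (g : ℂ → ℂ) :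
    ∫ q : ℝ × ℝ, g ⟨q.1, q.2⟩ = ∫ w, g w :=
  Complex.volume_preserving_equiv_real_prod.symm.integral_comp
    (MeasurableEquiv.measurableEmbedding _) g

open FourierTransform in
theorem exists_schwartz_fourier {h : ℝ × ℝ → ℂ} (hh : ContDiff ℝ (⊤ : ℕ∞) h)
    (hs : HasCompactSupport h) :
    ∃ S : SchwartzMap ℂ ℂ,
      (∀ k l : ℝ, ∫ q : ℝ × ℝ,
        Complex.exp (-Complex.I * (k * q.1 + l * q.2 : ℝ)) * h q = S ⟨k, l⟩) ∧
      ∀ x y : ℝ, ∫ q : ℝ × ℝ,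
        Complex.exp (Complex.I * (q.1 * x + q.2 * y : ℝ)) * S ⟨q.1, q.2⟩ =
          (2 * π) ^ 2 * h (x, y) := by
  have hπ : (2 * π) ≠ 0 := by positivity
  let e := Complex.equivRealProdCLM
  let ψ : SchwartzMap ℂ ℂ := HasCompactSupport.toSchwartzMap
    (hs.comp_homeomorph e.toHomeomorph) (hh.comp e.contDiff)
  have hψ : ∀ w : ℂ, ψ w = h (w.re, w.im) := fun w => rfl
  let A : ℂ ≃L[ℝ] ℂ := ContinuousLinearEquiv.smulLeft (Units.mk0 ((2 * π)⁻¹) (inv_ne_zero hπ))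
  let S : SchwartzMap ℂ ℂ := SchwartzMap.compCLMOfContinuousLinearEquiv ℂ A (𝓕 ψ)
  have hS : ∀ w, S w = 𝓕 (ψ : ℂ → ℂ) ((2 * π)⁻¹ • w) := fun w => by
    rw [← SchwartzMap.fourier_coe]; rfl
  refine ⟨S, fun k l => ?_, fun x y => ?_⟩
  · rw [hS, Real.fourier_eq', ← integral_equivRealProd]
    congr 1; ext q
    rw [hψ, smul_eq_mul]
    congr 2
    rw [mul_comm, neg_mul_comm, mul_comm]
    simp [Complex.inner]
    field_simp
  · have key := congrFun (ψ.continuous.fourierInv_fourier_eq ψ.integrable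
      (by rw [← SchwartzMap.fourier_coe]; exact (𝓕 ψ).integrable)) ⟨x, y⟩
    rw [hψ] at key
    simp only at key
    rw [← key, Real.fourierInv_eq']
    have hscale := Measure.integral_comp_smul (volume : Measure ℂ) (fun v : ℂ =>
      Complex.exp (((2 * π * inner ℝ v (⟨x, y⟩ : ℂ) : ℝ) : ℂ) * Complex.I) • 𝓕 (ψ : ℂ → ℂ) v)
      (2 * π)⁻¹
    rw [Complex.finrank_real_complex, inv_pow, inv_inv, abs_of_nonneg (by positivity),
      Complex.real_smul] at hscale
    push_cast at hscale ⊢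
    rw [← hscale, ← integral_equivRealProd]
    congr 1; ext q
    rw [hS, smul_eq_mul]
    congr 2
    simp [Complex.inner]
    field_simp

theorem SchwartzMap.integrable_abs_mul_line (S : SchwartzMap ℂ ℂ) (t : ℝ) :
    Integrable (fun k : ℝ => ((|k| : ℝ) : ℂ) * S ⟨k, k * t⟩) := by
  let A : ℝ →L[ℝ] ℂ := ContinuousLinearMap.toSpanSingleton ℝ (⟨1, t⟩ : ℂ)
  have hA : ∀ k : ℝ, A k = ⟨k, k * t⟩ := fun k => by
    apply Complex.ext <;> simp [A]
  have hanti : AntilipschitzWith 1 A := by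
    refine A.antilipschitz_of_bound fun k => ?_
    rw [hA, NNReal.coe_one, one_mul]
    exact Complex.abs_re_le_norm ⟨k, k * t⟩
  have h := (SchwartzMap.compCLMOfAntilipschitz ℂ A.hasTemperateGrowth hanti S).integrable_pow_mul
    volume 1
  refine h.mono ?_ ?_
  · apply Continuous.aestronglyMeasurable
    have h2 : Continuous fun k : ℝ => S (A k) := S.continuous.comp A.continuous
    simp only [hA] at h2
    exact (by fun_prop : Continuous fun k : ℝ => ((|k| : ℝ) : ℂ)).mul h2
  · refine Filter.Eventually.of_forall fun k => ?_
    simp [hA]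

theorem contDiff_rpow_mul {f : ℝ × ℝ → ℝ} (hf : ContDiff ℝ (⊤ : ℕ∞) f)
    (hfs : tsupport f ⊆ {q : ℝ × ℝ | 0 < q.2}) (r : ℝ) :
    ContDiff ℝ (⊤ : ℕ∞) (fun q : ℝ × ℝ => ((q.2 ^ r * f q : ℝ) : ℂ)) := by
  refine Complex.ofRealCLM.contDiff.comp (contDiff_iff_contDiffAt.2 fun q => ?_)
  by_cases hq : q ∈ tsupport f
  · exact (contDiffAt_snd.rpow_const_of_ne (hfs hq).ne').mul hf.contDiffAt
  · have h0 : (fun q : ℝ × ℝ => q.2 ^ r * f q) =ᶠ[nhds q] fun _ => 0 := by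
      filter_upwards [notMem_tsupport_iff_eventuallyEq.1 hq] with a ha
      simp [ha]
    exact contDiffAt_const.congr_of_eventuallyEq h0

theorem integral_Ioo_tan (Q : ℝ → ℂ) :
    ∫ θ in Set.Ioo (0 : ℝ) (π / 2), ((Real.cos θ ^ (-2 : ℝ) : ℝ) : ℂ) * Q (Real.tan θ) =
      ∫ t in Set.Ioi (0 : ℝ), Q t := by
  have hcos : ∀ θ ∈ Set.Ioo (0 : ℝ) (π / 2), 0 < Real.cos θ := fun θ hθ =>
    Real.cos_pos_of_mem_Ioo ⟨by linarith [hθ.1, pi_pos], hθ.2⟩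
  have himg : Real.tan '' Set.Ioo (0 : ℝ) (π / 2) = Set.Ioi 0 := by
    ext t
    constructor
    · rintro ⟨θ, hθ, rfl⟩
      exact Real.tan_pos_of_pos_of_lt_pi_div_two hθ.1 hθ.2
    · intro ht
      exact ⟨arctan t, ⟨Real.arctan_pos.2 ht, arctan_lt_pi_div_two t⟩, tan_arctan t⟩
  rw [← himg, integral_image_eq_integral_abs_deriv_smul measurableSet_Ioo
    (fun θ hθ => (Real.hasDerivAt_tan (hcos θ hθ).ne').hasDerivWithinAt)
    (Real.injOn_tan.mono (Set.Ioo_subset_Ioo_left (by linarith [pi_pos])))]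
  refine setIntegral_congr_fun measurableSet_Ioo fun θ hθ => ?_
  have h := hcos θ hθ
  simp only [Complex.real_smul]
  rw [abs_of_pos (by positivity), rpow_neg h.le, one_div]
  norm_num

theorem integral_Ioi_add_comp_neg {A : ℝ → ℂ} (hA : Integrable A) :
    ∫ t in Set.Ioi (0 : ℝ), (A t + A (-t)) = ∫ t, A t := by
  rw [integral_add hA.integrableOn hA.comp_neg.integrableOn, integral_comp_neg_Ioi, neg_zero,
    add_comm, intervalIntegral.integral_Iic_add_Ioi hA.integrableOn hA.integrableOn]

theorem coneRadon2_eq_integral_tan (p : ℝ) {f : ℝ × ℝ → ℝ}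
    (hfs : tsupport f ⊆ {q : ℝ × ℝ | 0 < q.2}) (u : ℝ) {θ : ℝ} (hθ : 0 < Real.cos θ) :
    coneRadon2 p f u θ = Real.cos θ ^ (p - 1) *
      ∫ z : ℝ, (z ^ (-p) * f (u + z * Real.tan θ, z) + z ^ (-p) * f (u - z * Real.tan θ, z)) := by
  have hzero : ∀ a z : ℝ, z ≤ 0 → f (a, z) = 0 := fun a z hz =>
    image_eq_zero_of_notMem_tsupport fun h => absurd (hfs h) (not_lt.2 hz)
  rw [← setIntegral_eq_integral_of_forall_compl_eq_zero (s := Set.Ioi (0 : ℝ)) (fun z hz => by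
    rw [hzero _ z (not_lt.1 hz), hzero _ z (not_lt.1 hz)]; simp)]
  have hscale := integral_comp_mul_right_Ioi (fun z : ℝ =>
    z ^ (-p) * f (u + z * Real.tan θ, z) + z ^ (-p) * f (u - z * Real.tan θ, z)) 0 hθ
  rw [zero_mul, smul_eq_mul, eq_inv_mul_iff_mul_eq₀ hθ.ne'] at hscale
  rw [← hscale, ← mul_assoc, ← integral_const_mul, coneRadon2]
  refine setIntegral_congr_fun measurableSet_Ioi fun s hs => ?_
  have hst : s * Real.cos θ * Real.tan θ = s * Real.sin θ := by
    rw [mul_assoc, mul_comm (Real.cos θ), Real.tan_mul_cos hθ.ne']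
  have hc : Real.cos θ ^ (p - 1) * Real.cos θ * Real.cos θ ^ (-p) = 1 := by
    rw [← rpow_add_one hθ.ne', ← rpow_add hθ]
    simp
  simp only [hst]
  rw [mul_rpow (le_of_lt hs) hθ.le]
  linear_combination (-(s ^ (-p) * (f (u + s * Real.sin θ, s * Real.cos θ) +
    f (u - s * Real.sin θ, s * Real.cos θ)))) * hc

theorem fourierFirst2_coneRadon2 (p : ℝ) {f : ℝ × ℝ → ℝ} (hfc : HasCompactSupport f)
    (hfs : tsupport f ⊆ {q : ℝ × ℝ | 0 < q.2})
    (hcont : Continuous (fun q : ℝ × ℝ => ((q.2 ^ (-p) * f q : ℝ) : ℂ))) {S : ℂ → ℂ}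
    (hS : ∀ k l : ℝ, ∫ q : ℝ × ℝ,
      Complex.exp (-Complex.I * (k * q.1 + l * q.2 : ℝ)) * ((q.2 ^ (-p) * f q : ℝ) : ℂ) = S ⟨k, l⟩)
    (k : ℝ) {θ : ℝ} (hθ : 0 < Real.cos θ) :
    fourierFirst2 (coneRadon2 p f) k θ = ((Real.cos θ ^ (p - 1) : ℝ) : ℂ) *
      (S ⟨k, k * Real.tan θ⟩ + S ⟨k, k * -Real.tan θ⟩) := by
  let Ψ : ℝ → ℝ × ℝ → ℂ := fun t q =>
    Complex.exp (-Complex.I * (k * q.1 + k * t * q.2 : ℝ)) * ((q.2 ^ (-p) * f q : ℝ) : ℂ)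
  have hΨc : ∀ t, Continuous (Ψ t) := fun t =>
    (by fun_prop : Continuous fun q : ℝ × ℝ =>
      Complex.exp (-Complex.I * (k * q.1 + k * t * q.2 : ℝ))).mul hcont
  have hΨs : ∀ t, HasCompactSupport (Ψ t) := fun t =>
    hfc.mono fun q hq hf => hq (by simp [Ψ, Function.notMem_support.1 (not_not.2 hf)])
  have hΨ : ∀ t, Integrable (fun q : ℝ × ℝ => Ψ (-t) (q.1 + q.2 * t, q.2)) ∧
      ∫ q : ℝ × ℝ, Ψ (-t) (q.1 + q.2 * t, q.2) = S ⟨k, k * -t⟩ := fun t =>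
    ⟨(integral_shear (hΨc _) (hΨs _) t).1,
      (integral_shear (hΨc _) (hΨs _) t).2.trans (hS k (k * -t))⟩
  have h₁ := hΨ (Real.tan θ)
  have h₂ := hΨ (-Real.tan θ)
  rw [neg_neg] at h₂
  rw [add_comm, ← h₁.2, ← h₂.2, ← integral_add h₁.1 h₂.1, Measure.volume_eq_prod,
    integral_prod _ (by exact h₁.1.add h₂.1),
    ← integral_const_mul, fourierFirst2]
  congr 1; ext u
  rw [coneRadon2_eq_integral_tan p hfs u hθ, Complex.ofReal_mul (Real.cos θ ^ (p - 1)), ← integral_complex_ofReal,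
    mul_left_comm, ← integral_const_mul]
  congr 2; ext z
  have e₁ : k * (u + z * Real.tan θ) + k * -Real.tan θ * z = k * u := by ring
  have e₂ : k * (u + z * -Real.tan θ) + k * Real.tan θ * z = k * u := by ring
  simp only [Ψ, e₁, e₂]
  rw [mul_neg, ← sub_eq_add_neg]
  push_cast
  ring

theorem integrable_mul_exp_I {g : ℝ → ℂ} (hg : Integrable g) (a : ℝ) :
    Integrable (fun k : ℝ => g k * Complex.exp (Complex.I * (k * a : ℝ))) := by
  refine hg.mono (hg.aestronglyMeasurable.mul
    (Continuous.aestronglyMeasurable (by fun_prop))) (Filter.Eventually.of_forall fun k => ?_)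
  rw [norm_mul, mul_comm Complex.I, Complex.norm_exp_ofReal_mul_I, mul_one]

theorem continuous_mk {S : ℂ → ℂ} (hS : Continuous S) :
    Continuous (fun q : ℝ × ℝ => S ⟨q.1, q.2⟩) :=
  hS.comp Complex.equivRealProdCLM.symm.continuous

/-- two-dimensional filtered back-projection, angle parametrization. -/
theorem coneRadon2_fbp_angle (p : ℝ) (f : ℝ × ℝ → ℝ)
    (hf : ContDiff ℝ (⊤ : ℕ∞) f) (hfc : HasCompactSupport f)
    (hfs : tsupport f ⊆ {q : ℝ × ℝ | 0 < q.2})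
    (x y : ℝ) (hy : 0 < y) :
    (f (x, y) : ℂ) =
      ((y ^ p / (2 * π) : ℝ) : ℂ) *
        ∫ θ in Set.Ioo (0 : ℝ) (π / 2),
          ((Real.cos θ ^ (-(1 + p)) : ℝ) : ℂ) *
            (filteredData2 p f (x + y * Real.tan θ) θ +
              filteredData2 p f (x - y * Real.tan θ) θ) := by
  have hh := contDiff_rpow_mul hf hfs (-p)
  obtain ⟨S, hS, hinv⟩ := exists_schwartz_fourier hh
    (hfc.mono fun q hq hf => hq (by simp [Function.notMem_support.1 (not_not.2 hf)]))
  let B : ℝ → ℝ → ℂ := fun a t =>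
    ∫ k : ℝ, ((|k| : ℝ) : ℂ) * S ⟨k, k * t⟩ * Complex.exp (Complex.I * (k * a : ℝ))
  have hB : ∀ a t : ℝ, Integrable (fun k : ℝ =>
      ((|k| : ℝ) : ℂ) * S ⟨k, k * t⟩ * Complex.exp (Complex.I * (k * a : ℝ))) := fun a t =>
    integrable_mul_exp_I (S.integrable_abs_mul_line t) a
  have hfilt : ∀ (u : ℝ) {θ : ℝ}, 0 < Real.cos θ → filteredData2 p f u θ =
      ((1 / (2 * π) : ℝ) : ℂ) * (((Real.cos θ ^ (p - 1) : ℝ) : ℂ) *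
        (B u (Real.tan θ) + B u (-Real.tan θ))) := fun u θ hθ => by
    rw [filteredData2, ← integral_add (hB _ _) (hB _ _),
      ← integral_const_mul ((Real.cos θ ^ (p - 1) : ℝ) : ℂ)]
    congr 1
    refine integral_congr_ae (Filter.Eventually.of_forall fun k => ?_)
    simp only
    rw [fourierFirst2_coneRadon2 p hfc hfs hh.continuous hS k hθ]
    ring
  let Φ : ℝ → ℝ × ℝ → ℂ := fun b q =>
    Complex.exp (Complex.I * (q.1 * x + q.2 * b : ℝ)) * S ⟨q.1, q.2⟩
  have hΦc : ∀ b, Continuous (Φ b) := fun b =>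
    (by fun_prop : Continuous fun q : ℝ × ℝ =>
      Complex.exp (Complex.I * (q.1 * x + q.2 * b : ℝ))).mul (continuous_mk S.continuous)
  have hΦi : ∀ b, Integrable (Φ b) := fun b => by
    refine (integrable_equivRealProd S.integrable).mono (hΦc b).aestronglyMeasurable
      (Filter.Eventually.of_forall fun q => ?_)
    rw [norm_mul, mul_comm Complex.I, Complex.norm_exp_ofReal_mul_I, one_mul]
  have hΦB : ∀ b t : ℝ, ∫ k : ℝ, ((|k| : ℝ) : ℂ) * Φ b (k, k * t) = B (x + b * t) t :=
    fun b t => by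
      refine integral_congr_ae (Filter.Eventually.of_forall fun k => ?_)
      have e : k * x + k * t * b = k * (x + b * t) := by ring
      simp only [Φ, e]
      ring
  have hBint : ∀ b, Integrable (fun t => B (x + b * t) t) := fun b => by
    simpa only [hΦB] using
      (integral_abs_mul_dilate (hΦc b) (hΦi b)).1.integral_prod_right
  have hBval : ∀ b, ∫ t, B (x + b * t) t =
      (2 * π) ^ 2 * ((b ^ (-p) * f (x, b) : ℝ) : ℂ) := fun b => by
    rw [← hinv x b, ← (integral_abs_mul_dilate (hΦc b) (hΦi b)).2]
    simp only [hΦB]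
  let A : ℝ → ℂ := fun t => B (x + y * t) t + B (x + -y * t) t
  have hAint : Integrable A := (hBint y).add (hBint (-y))
  have hcongr : ∫ θ in Set.Ioo (0 : ℝ) (π / 2), ((Real.cos θ ^ (-(1 + p)) : ℝ) : ℂ) *
      (filteredData2 p f (x + y * Real.tan θ) θ + filteredData2 p f (x - y * Real.tan θ) θ) =
      ∫ θ in Set.Ioo (0 : ℝ) (π / 2), ((1 / (2 * π) : ℝ) : ℂ) *
        (((Real.cos θ ^ (-2 : ℝ) : ℝ) : ℂ) * (A (Real.tan θ) + A (-Real.tan θ))) := by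
    refine setIntegral_congr_fun measurableSet_Ioo fun θ hθ => ?_
    have hc : 0 < Real.cos θ :=
      Real.cos_pos_of_mem_Ioo ⟨by linarith [hθ.1, pi_pos], hθ.2⟩
    have hpow : Real.cos θ ^ (-2 : ℝ) = Real.cos θ ^ (-(1 + p)) * Real.cos θ ^ (p - 1) := by
      rw [← rpow_add hc]; congr 1; ring
    simp only [hfilt _ hc, hpow, A, ← sub_eq_add_neg, neg_mul, mul_neg,
      Complex.ofReal_mul, sub_neg_eq_add]
    ring
  have hneg : f (x, -y) = 0 :=
    image_eq_zero_of_notMem_tsupport fun h => absurd (hfs h) (by simp [hy.le])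
  rw [hcongr, integral_const_mul, integral_Ioo_tan (fun t => A t + A (-t)),
    integral_Ioi_add_comp_neg hAint, integral_add (hBint y) (hBint (-y)), hBval, hBval, hneg]
  have hyp : y ^ p * y ^ (-p) = 1 := by rw [← rpow_add hy]; simp
  have hπ : (π : ℂ) ≠ 0 := by exact_mod_cast pi_ne_zero
  have hyp' : ((y ^ p : ℝ) : ℂ) * ((y ^ (-p) : ℝ) : ℂ) = 1 := by exact_mod_cast hyp
  push_cast
  field_simp
  linear_combination (-(f (x, y) : ℂ)) * hyp'
end
end

section
/- Let p ∈ ℝ and let f : ℝ × ℝ → ℝ be smooth with compact support contained in ℝ × (0,∞). For every x ∈ ℝ and y > 0: f(x, y) = (1/(2π)) · ∫_ℝ (|u − x|² + y²)^{(p−1)/2} · g(u, arctan(|u − x| / y)) du, where g(u, θ) := (1/(2π)) ∫_ℝ |k| (F R^(p) f)(k, θ) e^{iku} dk is the filtered data (equal to ∂_u H_u R^(p) f, the derivative of the Hilbert transform in the first argument). -/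
open MeasureTheory Real

noncomputable section

open scoped FourierTransform ContDiff

/-- The non-unitary Fourier transform on the plane. -/
def planeFourier (G : ℝ × ℝ → ℂ) (ξ : ℝ × ℝ) : ℂ :=
  ∫ q : ℝ × ℝ, Complex.exp (-Complex.I * (ξ.1 * q.1 + ξ.2 * q.2 : ℝ)) * G q

theorem exists_schwartz_planeFourier {G : ℝ × ℝ → ℂ} (hG : ContDiff ℝ ∞ G)
    (hGc : HasCompactSupport G) :
    ∃ S : SchwartzMap (WithLp 2 (ℝ × ℝ)) ℂ, (∀ v, S v = G v.ofLp) ∧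
      ∀ ξ, planeFourier G ξ = 𝓕 S (WithLp.toLp 2 ((2 * π)⁻¹ • ξ)) := by
  let e : WithLp 2 (ℝ × ℝ) ≃L[ℝ] ℝ × ℝ := WithLp.prodContinuousLinearEquiv 2 ℝ ℝ ℝ
  have hc : HasCompactSupport (G ∘ e) := hGc.comp_homeomorph e.toHomeomorph
  refine ⟨hc.toSchwartzMap (hG.comp e.contDiff), fun v => rfl, fun ξ => ?_⟩
  rw [SchwartzMap.fourier_coe, Real.fourier_eq',
    ← (WithLp.volume_preserving_toLp ℝ ℝ).integral_comp
      (MeasurableEquiv.toLp 2 (ℝ × ℝ)).measurableEmbedding, planeFourier]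
  refine integral_congr_ae (.of_forall fun q => ?_)
  have : -2 * π * inner ℝ (WithLp.toLp 2 q) (WithLp.toLp 2 ((2 * π)⁻¹ • ξ)) =
      -(ξ.1 * q.1 + ξ.2 * q.2) := by
    simp [WithLp.prod_inner_apply]
    field_simp
    ring
  simp only [smul_eq_mul]
  rw [this]
  congr 2
  push_cast
  ring

theorem continuous_planeFourier {G : ℝ × ℝ → ℂ} (hG : ContDiff ℝ ∞ G)
    (hGc : HasCompactSupport G) : Continuous (planeFourier G) := by
  obtain ⟨S, -, hS⟩ := exists_schwartz_planeFourier hG hGc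
  rw [funext hS]
  exact (𝓕 S).continuous.comp
    ((WithLp.prodContinuousLinearEquiv 2 ℝ ℝ ℝ).symm.continuous.comp (continuous_const_smul _))

theorem integrable_planeFourier {G : ℝ × ℝ → ℂ} (hG : ContDiff ℝ ∞ G)
    (hGc : HasCompactSupport G) : Integrable (planeFourier G) := by
  obtain ⟨S, -, hS⟩ := exists_schwartz_planeFourier hG hGc
  rw [funext hS]
  have h : Integrable (fun q : ℝ × ℝ => 𝓕 S (WithLp.toLp 2 q)) :=
    ((WithLp.volume_preserving_toLp ℝ ℝ).integrable_comp_emb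
      (MeasurableEquiv.toLp 2 (ℝ × ℝ)).measurableEmbedding).2 (𝓕 S).integrable
  exact h.comp_smul (by positivity)

theorem integral_planeFourier_mul_exp {G : ℝ × ℝ → ℂ} (hG : ContDiff ℝ ∞ G)
    (hGc : HasCompactSupport G) (q : ℝ × ℝ) :
    ∫ ξ, planeFourier G ξ * Complex.exp (Complex.I * (ξ.1 * q.1 + ξ.2 * q.2 : ℝ)) =
      ((4 * π ^ 2 : ℝ) : ℂ) * G q := by
  obtain ⟨S, hSG, hS⟩ := exists_schwartz_planeFourier hG hGc
  have hinv : 𝓕⁻ (𝓕 (S : WithLp 2 (ℝ × ℝ) → ℂ)) (WithLp.toLp 2 q) = S (WithLp.toLp 2 q) := by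
    rw [S.continuous.fourierInv_fourier_eq S.integrable (𝓕 S).integrable]
  rw [← SchwartzMap.fourier_coe, hSG, Real.fourierInv_eq',
    ← (WithLp.volume_preserving_toLp ℝ ℝ).integral_comp
      (MeasurableEquiv.toLp 2 (ℝ × ℝ)).measurableEmbedding] at hinv
  rw [← hinv]
  have key := Measure.integral_comp_smul (volume : Measure (ℝ × ℝ))
    (fun v : ℝ × ℝ => Complex.exp
      (↑(2 * π * inner ℝ (WithLp.toLp 2 v) (WithLp.toLp 2 q)) * Complex.I) •
        𝓕 S (WithLp.toLp 2 v)) (2 * π)⁻¹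
  have hpi : |(((2 * π)⁻¹ : ℝ) ^ Module.finrank ℝ (ℝ × ℝ))⁻¹| = 4 * π ^ 2 := by
    rw [Module.finrank_prod, Module.finrank_self, abs_of_nonneg (by positivity), inv_pow, inv_inv]
    ring
  rw [hpi, Complex.real_smul] at key
  rw [← key]
  refine integral_congr_ae (.of_forall fun ξ => ?_)
  have : 2 * π * inner ℝ (WithLp.toLp 2 ((2 * π)⁻¹ • ξ)) (WithLp.toLp 2 q) =
      ξ.1 * q.1 + ξ.2 * q.2 := by
    simp [WithLp.prod_inner_apply]
    field_simp
  simp only [smul_eq_mul]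
  rw [this, hS, mul_comm, mul_comm Complex.I]

theorem integrable_abs_mul_planeFourier_shear {G : ℝ × ℝ → ℂ} (hG : ContDiff ℝ ∞ G)
    (hGc : HasCompactSupport G) (x y : ℝ) :
    Integrable (fun r : ℝ × ℝ => ((|r.1| : ℝ) : ℂ) * planeFourier G (r.1, r.1 * r.2) *
      Complex.exp (Complex.I * (r.1 * (x + y * r.2) : ℝ))) := by
  have hcont := continuous_planeFourier hG hGc
  have hint := integrable_planeFourier hG hGc
  have hm : Continuous (fun r : ℝ × ℝ => ((|r.1| : ℝ) : ℂ) * planeFourier G (r.1, r.1 * r.2) *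
      Complex.exp (Complex.I * (r.1 * (x + y * r.2) : ℝ))) := by fun_prop
  have hnorm (k t : ℝ) : ‖((|k| : ℝ) : ℂ) * planeFourier G (k, k * t) *
      Complex.exp (Complex.I * (k * (x + y * t) : ℝ))‖ = |k| * ‖planeFourier G (k, k * t)‖ := by
    rw [norm_mul, norm_mul, mul_comm Complex.I, Complex.norm_exp_ofReal_mul_I, mul_one,
      Complex.norm_real, norm_eq_abs, abs_abs]
  have hk : ∀ᵐ k : ℝ, k ≠ 0 := by simp [ae_iff]
  rw [Measure.volume_eq_prod] at hint ⊢
  rw [integrable_prod_iff hint.aestronglyMeasurable] at hint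
  rw [integrable_prod_iff hm.aestronglyMeasurable]
  constructor
  · filter_upwards [hint.1, hk] with k h hk
    refine ((h.comp_mul_left' hk).norm.const_mul |k|).mono'
      (by fun_prop) (.of_forall fun t => (hnorm k t).le)
  · refine hint.2.congr ?_
    filter_upwards [hk] with k hk
    simp only [hnorm]
    rw [integral_const_mul, Measure.integral_comp_mul_left (fun η => ‖planeFourier G (k, η)‖),
      smul_eq_mul, ← mul_assoc, abs_inv, mul_inv_cancel₀ (abs_ne_zero.2 hk), one_mul]

theorem integral_abs_mul_planeFourier_shear {G : ℝ × ℝ → ℂ} (hG : ContDiff ℝ ∞ G)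
    (hGc : HasCompactSupport G) (x y : ℝ) :
    ∫ r : ℝ × ℝ, ((|r.1| : ℝ) : ℂ) * planeFourier G (r.1, r.1 * r.2) *
      Complex.exp (Complex.I * (r.1 * (x + y * r.2) : ℝ)) = ((4 * π ^ 2 : ℝ) : ℂ) * G (x, y) := by
  have hint := integrable_planeFourier hG hGc
  rw [← integral_planeFourier_mul_exp hG hGc]
  have hint' : Integrable (fun ξ : ℝ × ℝ => planeFourier G ξ *
      Complex.exp (Complex.I * (ξ.1 * x + ξ.2 * y : ℝ))) := by
    refine hint.mono (hint.aestronglyMeasurable.mul (by fun_prop)) (.of_forall fun ξ => ?_)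
    rw [norm_mul, mul_comm Complex.I, Complex.norm_exp_ofReal_mul_I, mul_one]
  have hsh := integrable_abs_mul_planeFourier_shear hG hGc x y
  rw [Measure.volume_eq_prod] at hsh hint' ⊢
  rw [integral_prod _ hsh, integral_prod _ hint']
  have hk : ∀ᵐ k : ℝ, k ≠ 0 := by simp [ae_iff]
  refine integral_congr_ae ?_
  filter_upwards [hk] with k hk
  have := Measure.integral_comp_mul_left (fun η => planeFourier G (k, η) *
    Complex.exp (Complex.I * (k * x + η * y : ℝ))) k
  simp only [mul_assoc]
  rw [integral_const_mul]
  have h2 : ∫ t : ℝ, planeFourier G (k, k * t) * Complex.exp (Complex.I * (k * (x + y * t) : ℝ)) =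
      ∫ t : ℝ, planeFourier G (k, k * t) * Complex.exp (Complex.I * (k * x + k * t * y : ℝ)) := by
    refine integral_congr_ae (.of_forall fun t => ?_)
    simp only
    congr 4
    ring
  rw [h2, this, Complex.real_smul, ← mul_assoc, ← Complex.ofReal_mul, abs_inv,
    mul_inv_cancel₀ (abs_ne_zero.2 hk), Complex.ofReal_one, one_mul]

/-- The shear `(u, z) ↦ (u + z t, z)` of the plane. -/
def shearHomeomorph (t : ℝ) : ℝ × ℝ ≃ₜ ℝ × ℝ where
  toFun q := (q.1 + q.2 * t, q.2)
  invFun q := (q.1 - q.2 * t, q.2)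
  left_inv q := by simp
  right_inv q := by simp
  continuous_toFun := by fun_prop
  continuous_invFun := by fun_prop

theorem integrable_comp_shear {G : ℝ × ℝ → ℂ} (hG : Continuous G)
    (hGc : HasCompactSupport G) (t : ℝ) :
    Integrable (fun q : ℝ × ℝ => G (q.1 + q.2 * t, q.2)) :=
  (hG.comp (shearHomeomorph t).continuous).integrable_of_hasCompactSupport
    (hGc.comp_homeomorph (shearHomeomorph t))

theorem integrable_exp_mul {α : Type*} [MeasurableSpace α] {μ : Measure α} {g : α → ℂ}
    (hg : Integrable g μ) {φ : α → ℝ} (hφ : Measurable φ) :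
    Integrable (fun a => Complex.exp (-Complex.I * (φ a : ℝ)) * g a) μ := by
  refine hg.mono (.mul (by fun_prop) hg.aestronglyMeasurable) (.of_forall fun a => ?_)
  rw [norm_mul, show -Complex.I * (φ a : ℂ) = ((-φ a : ℝ) : ℂ) * Complex.I by push_cast; ring,
    Complex.norm_exp_ofReal_mul_I, one_mul]

theorem fourier_line_integral {G : ℝ × ℝ → ℂ} (hG : Continuous G)
    (hGc : HasCompactSupport G) (k t : ℝ) :
    ∫ u : ℝ, Complex.exp (-Complex.I * (k * u : ℝ)) * ∫ z : ℝ, G (u + z * t, z) =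
      planeFourier G (k, -(k * t)) := by
  have h1 : Integrable (fun q : ℝ × ℝ => Complex.exp (-Complex.I * (k * q.1 : ℝ)) *
      G (q.1 + q.2 * t, q.2)) :=
    integrable_exp_mul (integrable_comp_shear hG hGc t) (by fun_prop)
  have h2 : Integrable (fun q : ℝ × ℝ =>
      Complex.exp (-Complex.I * (k * q.1 + -(k * t) * q.2 : ℝ)) * G q) :=
    integrable_exp_mul (hG.integrable_of_hasCompactSupport hGc) (by fun_prop)
  simp_rw [← integral_const_mul]
  rw [planeFourier]
  rw [Measure.volume_eq_prod] at h1 h2 ⊢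
  rw [integral_integral_swap h1, integral_prod_symm _ h2]
  refine integral_congr_ae (.of_forall fun z => ?_)
  simp only
  conv_rhs => rw [← integral_add_right_eq_self _ (z * t)]
  refine integral_congr_ae (.of_forall fun u => ?_)
  simp only
  congr 4
  ring

theorem integrable_line_integral {G : ℝ × ℝ → ℂ} (hG : Continuous G)
    (hGc : HasCompactSupport G) (t : ℝ) : Integrable (fun u : ℝ => ∫ z : ℝ, G (u + z * t, z)) :=
  Integrable.integral_prod_left (integrable_comp_shear hG hGc t)

theorem integrable_section_line {F : ℝ × ℝ → ℝ} (hF : Continuous F)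
    (hFc : HasCompactSupport F) (u t : ℝ) : Integrable (fun z : ℝ => F (u + z * t, z)) := by
  refine Continuous.integrable_of_hasCompactSupport (by fun_prop) ?_
  refine HasCompactSupport.intro (hFc.image continuous_snd) fun z hz => ?_
  by_contra h
  exact hz ⟨(u + z * t, z), subset_tsupport _ h, rfl⟩

theorem coneRadon2_eq_line_integrals (p : ℝ) {f : ℝ × ℝ → ℝ} (hf : ∀ a z, z ≤ 0 → f (a, z) = 0)
    (u θ : ℝ) (hθ : 0 < Real.cos θ) :
    coneRadon2 p f u θ = Real.cos θ ^ (p - 1) *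
      ∫ z : ℝ, (z ^ (-p) * f (u + z * Real.tan θ, z) + z ^ (-p) * f (u + z * -Real.tan θ, z)) := by
  set g : ℝ → ℝ := fun z =>
    z ^ (-p) * f (u + z * Real.tan θ, z) + z ^ (-p) * f (u + z * -Real.tan θ, z) with hg
  have h0 : ∫ z in Set.Ioi (0 : ℝ), g z = ∫ z, g z := by
    refine setIntegral_eq_integral_of_forall_compl_eq_zero fun z hz => ?_
    have hz : z ≤ 0 := not_lt.1 hz
    simp [hg, hf _ z hz]
  have h1 := integral_comp_mul_left_Ioi g 0 hθ
  rw [mul_zero, h0, smul_eq_mul] at h1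
  have h2 : coneRadon2 p f u θ =
      Real.cos θ ^ p * ∫ s in Set.Ioi (0 : ℝ), g (Real.cos θ * s) := by
    rw [coneRadon2, ← integral_const_mul]
    refine setIntegral_congr_fun measurableSet_Ioi fun s hs => ?_
    have hs : 0 < s := hs
    have ht : Real.cos θ * s * Real.tan θ = s * Real.sin θ := by
      rw [Real.tan_eq_sin_div_cos]
      field_simp
    have hc : Real.cos θ ^ p * Real.cos θ ^ (-p) = 1 := by
      rw [← Real.rpow_add hθ, add_neg_cancel, Real.rpow_zero]
    simp only [hg]
    rw [mul_neg, ht, Real.mul_rpow hθ.le hs.le, mul_comm (Real.cos θ) s, ← sub_eq_add_neg]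
    linear_combination (-(s ^ (-p) * (f (u + s * Real.sin θ, s * Real.cos θ) +
      f (u - s * Real.sin θ, s * Real.cos θ)))) * hc
  rw [h2, h1, Real.rpow_sub_one hθ.ne']
  ring

theorem fourierFirst2_coneRadon2_s3 (p : ℝ) {f F : ℝ × ℝ → ℝ}
    (hf : ∀ a z, z ≤ 0 → f (a, z) = 0) (hF : Continuous F) (hFc : HasCompactSupport F)
    (hfF : ∀ a z, F (a, z) = z ^ (-p) * f (a, z)) (k θ : ℝ) (hθ : 0 < Real.cos θ) :
    fourierFirst2 (coneRadon2 p f) k θ = ((Real.cos θ ^ (p - 1) : ℝ) : ℂ) *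
      (planeFourier (fun q => (F q : ℂ)) (k, k * Real.tan θ) +
        planeFourier (fun q => (F q : ℂ)) (k, k * -Real.tan θ)) := by
  have hG : Continuous (fun q => (F q : ℂ)) := by fun_prop
  have hGc : HasCompactSupport (fun q => (F q : ℂ)) := hFc.comp_left Complex.ofReal_zero
  have hR (u : ℝ) : (coneRadon2 p f u θ : ℂ) = ((Real.cos θ ^ (p - 1) : ℝ) : ℂ) *
      ((∫ z : ℝ, (F (u + z * Real.tan θ, z) : ℂ)) + ∫ z : ℝ, (F (u + z * -Real.tan θ, z) : ℂ)) := by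
    rw [coneRadon2_eq_line_integrals p hf u θ hθ]
    simp_rw [← hfF]
    rw [integral_add (integrable_section_line hF hFc _ _) (integrable_section_line hF hFc _ _)]
    push_cast [integral_complex_ofReal]
    rfl
  have hi (t : ℝ) := integrable_exp_mul (integrable_line_integral hG hGc t)
    (φ := fun u => k * u) (by fun_prop)
  rw [fourierFirst2]
  simp_rw [hR, mul_left_comm _ ((Real.cos θ ^ (p - 1) : ℝ) : ℂ), mul_add]
  rw [integral_add, integral_const_mul, integral_const_mul, fourier_line_integral hG hGc,
    fourier_line_integral hG hGc, mul_neg, neg_neg, add_comm]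
  · exact (hi _).const_mul _
  · exact (hi _).const_mul _

theorem contDiff_rpow_mul_of_tsupport_subset (r : ℝ) {f : ℝ × ℝ → ℝ} (hf : ContDiff ℝ ∞ f)
    (hfs : tsupport f ⊆ {q : ℝ × ℝ | 0 < q.2}) :
    ContDiff ℝ ∞ (fun q : ℝ × ℝ => q.2 ^ r * f q) := by
  rw [contDiff_iff_contDiffAt]
  intro q
  by_cases hq : q ∈ tsupport f
  · exact (contDiff_snd.contDiffAt.rpow_const_of_ne (ne_of_gt (hfs hq))).mul hf.contDiffAt
  · have : (fun q : ℝ × ℝ => q.2 ^ r * f q) =ᶠ[nhds q] fun _ => 0 := by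
      filter_upwards [notMem_tsupport_iff_eventuallyEq.1 hq] with a ha
      simp [ha]
    exact contDiffAt_const.congr_of_eventuallyEq this

/-- two-dimensional filtered back-projection, vertex parametrization. -/
theorem coneRadon2_fbp_vertex (p : ℝ) (f : ℝ × ℝ → ℝ)
    (hf : ContDiff ℝ (⊤ : ℕ∞) f) (hfc : HasCompactSupport f)
    (hfs : tsupport f ⊆ {q : ℝ × ℝ | 0 < q.2})
    (x y : ℝ) (hy : 0 < y) :
    (f (x, y) : ℂ) =
      ((1 / (2 * π) : ℝ) : ℂ) *
        ∫ u : ℝ, (((|u - x| ^ 2 + y ^ 2) ^ ((p - 1) / 2) : ℝ) : ℂ) *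
          filteredData2 p f u (Real.arctan (|u - x| / y)) := by
  set F : ℝ × ℝ → ℝ := fun q => q.2 ^ (-p) * f q with hFdef
  have hf0 (a z : ℝ) (hz : z ≤ 0) : f (a, z) = 0 :=
    image_eq_zero_of_notMem_tsupport fun h => not_lt.2 hz (hfs h)
  have hFs : ContDiff ℝ ∞ F := contDiff_rpow_mul_of_tsupport_subset (-p) hf hfs
  have hFc : HasCompactSupport F := hfc.mul_left
  set G : ℝ × ℝ → ℂ := fun q => (F q : ℂ) with hGdef
  have hG : ContDiff ℝ ∞ G := Complex.ofRealCLM.contDiff.comp hFs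
  have hGc : HasCompactSupport G := hFc.comp_left Complex.ofReal_zero
  set P : ℝ × ℝ → ℂ := fun r => ((|r.1| : ℝ) : ℂ) * planeFourier G (r.1, r.1 * r.2) *
    Complex.exp (Complex.I * (r.1 * (x + y * r.2) : ℝ)) with hP
  set Q : ℝ × ℝ → ℂ := fun r => ((|r.1| : ℝ) : ℂ) * planeFourier G (r.1, r.1 * -r.2) *
    Complex.exp (Complex.I * (r.1 * (x + y * r.2) : ℝ)) with hQ
  have hPi : Integrable P := integrable_abs_mul_planeFourier_shear hG hGc x y
  have hmp : MeasurePreserving (Prod.map id Neg.neg : ℝ × ℝ → ℝ × ℝ) :=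
    (MeasurePreserving.id volume).prod (Measure.measurePreserving_neg volume)
  have hme : MeasurableEmbedding (Prod.map id Neg.neg : ℝ × ℝ → ℝ × ℝ) :=
    ((Homeomorph.refl ℝ).prodCongr (Homeomorph.neg ℝ)).measurableEmbedding
  have hQcomp : Q = (fun r : ℝ × ℝ => ((|r.1| : ℝ) : ℂ) * planeFourier G (r.1, r.1 * r.2) *
      Complex.exp (Complex.I * (r.1 * (x + -y * r.2) : ℝ))) ∘ Prod.map id Neg.neg := by
    funext r
    simp [hQ]
  have hQi : Integrable Q := by
    rw [hQcomp, hmp.integrable_comp_emb hme]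
    exact integrable_abs_mul_planeFourier_shear hG hGc x (-y)
  have hPint : ∫ r, P r = ((4 * π ^ 2 : ℝ) : ℂ) * G (x, y) :=
    integral_abs_mul_planeFourier_shear hG hGc x y
  have hQint : ∫ r, Q r = 0 := by
    rw [hQcomp]
    simp only [Function.comp_def]
    rw [hmp.integral_comp hme (fun r : ℝ × ℝ => ((|r.1| : ℝ) : ℂ) *
      planeFourier G (r.1, r.1 * r.2) * Complex.exp (Complex.I * (r.1 * (x + -y * r.2) : ℝ))),
      integral_abs_mul_planeFourier_shear hG hGc x (-y)]
    simp [hGdef, hFdef, hf0 x (-y) (by linarith)]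
  have hdata (t : ℝ) : (((|(x + y * t) - x| ^ 2 + y ^ 2) ^ ((p - 1) / 2) : ℝ) : ℂ) *
      filteredData2 p f (x + y * t) (Real.arctan (|(x + y * t) - x| / y)) =
      ((y ^ (p - 1) * (1 / (2 * π)) : ℝ) : ℂ) * ∫ k : ℝ, (P (k, t) + Q (k, t)) := by
    have habs : |x + y * t - x| = y * |t| := by rw [add_sub_cancel_left, abs_mul, abs_of_pos hy]
    rw [habs, mul_div_cancel_left₀ _ hy.ne', filteredData2]
    have hc : 0 < Real.cos (Real.arctan |t|) := Real.cos_arctan_pos _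
    have hfour (k : ℝ) : fourierFirst2 (coneRadon2 p f) k (Real.arctan |t|) =
        ((Real.cos (Real.arctan |t|) ^ (p - 1) : ℝ) : ℂ) *
          (planeFourier G (k, k * |t|) + planeFourier G (k, k * -|t|)) := by
      simpa only [Real.tan_arctan] using
        fourierFirst2_coneRadon2_s3 p hf0 hFs.continuous hFc (fun _ _ => rfl) k _ hc
    have hw : ((y * |t|) ^ 2 + y ^ 2) ^ ((p - 1) / 2) * Real.cos (Real.arctan |t|) ^ (p - 1) =
        y ^ (p - 1) := by
      have hpos : 0 < 1 + |t| ^ 2 := by positivity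
      rw [Real.cos_arctan, show (y * |t|) ^ 2 + y ^ 2 = y ^ 2 * (1 + |t| ^ 2) by ring,
        Real.mul_rpow (by positivity) hpos.le, one_div, Real.inv_rpow (by positivity),
        Real.sqrt_eq_rpow, ← Real.rpow_mul hpos.le, ← Real.rpow_natCast y 2,
        ← Real.rpow_mul hy.le, mul_assoc, show 1 / 2 * (p - 1) = (p - 1) / 2 by ring,
        mul_inv_cancel₀ (by positivity)]
      push_cast
      ring_nf
    have hPQ (k : ℝ) : ((|k| : ℝ) : ℂ) * (((Real.cos (Real.arctan |t|) ^ (p - 1) : ℝ) : ℂ) *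
        (planeFourier G (k, k * |t|) + planeFourier G (k, k * -|t|))) *
        Complex.exp (Complex.I * (k * (x + y * t) : ℝ)) =
        ((Real.cos (Real.arctan |t|) ^ (p - 1) : ℝ) : ℂ) * (P (k, t) + Q (k, t)) := by
      simp only [hP, hQ]
      rcases abs_choice t with h | h <;> rw [h]
      · ring
      · rw [neg_neg]
        ring
    simp_rw [hfour, hPQ]
    rw [integral_const_mul, ← hw]
    push_cast
    ring
  set H : ℝ → ℂ := fun u => (((|u - x| ^ 2 + y ^ 2) ^ ((p - 1) / 2) : ℝ) : ℂ) *
    filteredData2 p f u (Real.arctan (|u - x| / y)) with hH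
  have hchange : ∫ u, H u = (y : ℂ) * ∫ t, H (x + y * t) := by
    rw [Measure.integral_comp_mul_left (fun v => H (x + v)), integral_add_left_eq_self,
      Complex.real_smul, ← mul_assoc, ← Complex.ofReal_mul, abs_of_pos (inv_pos.2 hy),
      mul_inv_cancel₀ hy.ne', Complex.ofReal_one, one_mul]
  have hsum : ∫ t : ℝ, ∫ k : ℝ, (P (k, t) + Q (k, t)) = ((4 * π ^ 2 : ℝ) : ℂ) * G (x, y) := by
    have := integral_prod_symm (μ := volume) (ν := volume) (fun r => P r + Q r) (hPi.add hQi)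
    rw [← this, ← Measure.volume_eq_prod, integral_add hPi hQi, hPint, hQint, add_zero]
  have hyp : y * y ^ (p - 1) * y ^ (-p) = 1 := by
    rw [Real.rpow_sub_one hy.ne', mul_div_cancel₀ _ hy.ne', ← Real.rpow_add hy, add_neg_cancel,
      Real.rpow_zero]
  rw [hchange]
  simp only [hH, hdata]
  rw [integral_const_mul, hsum, hGdef, hFdef]
  simp only [← Complex.ofReal_mul]
  congr 1
  have hpi := Real.pi_ne_zero
  field_simp
  linear_combination (-4 * f (x, y)) * hyp
end
end

section
/- Let p ∈ ℝ and let f : ℝ² × ℝ → ℝ be smooth with compact support contained in ℝ² × (0,∞). For every x ∈ ℝ² and y > 0: f(x, y) = −(y^p / (4π²)) · ∫_0^{π/2} cos(θ)^{-(1+p)} ∫_{S^1} (Δ_u R^(p) f)(x + y·tan(θ)·n, θ) dn dθ, where Δ_u denotes the Laplacian of R^(p) f with respect to its first (two-dimensional) argument and S^1 is the unit circle in ℝ² with arclength measure. -/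
open MeasureTheory Real Metric
open scoped RealInnerProductSpace

noncomputable section

/-- The arclength measure on the unit circle `S^1 ⊆ ℝ²`. -/
def circleMeasure : Measure (sphere (0 : EuclideanSpace ℝ (Fin 2)) 1) :=
  (volume : Measure (EuclideanSpace ℝ (Fin 2))).toSphere

/-- The three-dimensional conical Radon transform with radial weight `1/s^p`:
`(R^(p) f)(u, θ) = ∫_0^∞ s^(-p) ∫_{S^1} f(u + s sin θ n, s cos θ) (s sin θ) dn ds`. -/
def coneRadon3 (p : ℝ) (f : EuclideanSpace ℝ (Fin 2) × ℝ → ℝ)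
    (u : EuclideanSpace ℝ (Fin 2)) (θ : ℝ) : ℝ :=
  ∫ s in Set.Ioi (0 : ℝ),
    s ^ (-p) *
      ∫ n, f (u + (s * Real.sin θ) • (n : EuclideanSpace ℝ (Fin 2)), s * Real.cos θ) *
          (s * Real.sin θ) ∂circleMeasure

/-- The Laplacian of a function on `ℝ²`, as the sum of the second partial derivatives. -/
def lap2 (h : EuclideanSpace ℝ (Fin 2) → ℝ) (u : EuclideanSpace ℝ (Fin 2)) : ℝ :=
  ∑ i : Fin 2,
    fderiv ℝ (fun v => fderiv ℝ h v (EuclideanSpace.single i (1 : ℝ))) u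
      (EuclideanSpace.single i (1 : ℝ))

open Set Filter Topology
open scoped Pointwise ENNReal

/-- The plane `ℝ²`. -/
abbrev Plane := EuclideanSpace ℝ (Fin 2)

/-- The unit vector at angle `α`. -/
def ang (α : ℝ) : Plane := !₂[cos α, sin α]

lemma contDiff_ang : ContDiff ℝ (⊤ : ℕ∞) ang := by
  rw [contDiff_euclidean]
  intro i
  fin_cases i
  · exact contDiff_cos
  · exact contDiff_sin

@[fun_prop]
lemma continuous_ang : Continuous ang := contDiff_ang.continuous

@[simp]
lemma norm_ang (α : ℝ) : ‖ang α‖ = 1 := by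
  simp [ang, EuclideanSpace.norm_eq]

lemma ang_periodic : Function.Periodic ang (2 * π) := fun α => by
  simp [ang]

lemma hasDerivAt_ang (α : ℝ) : HasDerivAt ang (ang (α + π / 2)) α := by
  have h : HasDerivAt (fun β => ![cos β, sin β]) ![cos (α + π / 2), sin (α + π / 2)] α := by
    rw [hasDerivAt_pi]
    intro i
    fin_cases i
    · simpa [cos_add_pi_div_two] using hasDerivAt_cos α
    · simpa [sin_add_pi_div_two] using hasDerivAt_sin α
  exact (PiLp.continuousLinearEquiv 2 ℝ (fun _ : Fin 2 => ℝ)).symm.hasFDerivAt.comp_hasDerivAt α h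

lemma measurableSet_cone (s : Set (sphere (0 : Plane) 1)) (hs : MeasurableSet s) :
    MeasurableSet (Ioo (0 : ℝ) 1 • ((↑) '' s : Set Plane)) := by
  have h : Ioo (0 : ℝ) 1 • ((↑) '' s : Set Plane) =
      (↑) '' (homeomorphUnitSphereProd Plane ⁻¹' s ×ˢ
        Iio (⟨1, mem_Ioi.2 one_pos⟩ : Ioi (0 : ℝ))) := by
    have h1 : Ioo (0 : ℝ) 1 = (↑) '' Iio (⟨1, mem_Ioi.2 one_pos⟩ : Ioi (0 : ℝ)) := by simp
    rw [← image2_smul, image2_image_right, ← Homeomorph.image_symm, image_image, h1,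
      image2_image_left, image2_swap, ← image_prod]
    rfl
  rw [h]
  exact (measurableSet_singleton (0 : Plane)).compl.subtype_image
    ((homeomorphUnitSphereProd Plane).measurable (hs.prod measurableSet_Iio))

lemma mem_cone_iff (s : Set (sphere (0 : Plane) 1)) {r : ℝ} (hr : 0 < r) (α : ℝ) :
    r • ang α ∈ Ioo (0 : ℝ) 1 • ((↑) '' s : Set Plane) ↔
      r < 1 ∧ (⟨ang α, by simp⟩ : sphere (0 : Plane) 1) ∈ s := by
  constructor
  · rintro ⟨t, ht, _, ⟨n, hn, rfl⟩, h⟩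
    have hn1 : ‖(n : Plane)‖ = 1 := by simp
    have h' : t • (n : Plane) = r • ang α := h
    have htr : t = r := by
      have := congrArg norm h'
      simpa [norm_smul, abs_of_pos hr, abs_of_pos ht.1] using this
    subst htr
    have h2 : (n : Plane) = ang α := smul_right_injective _ hr.ne' h'
    refine ⟨ht.2, ?_⟩
    convert hn
    exact h2.symm
  · rintro ⟨h1, h2⟩
    exact Set.smul_mem_smul ⟨hr, h1⟩ (mem_image_of_mem _ h2)

lemma volume_cone_eq_lintegral (s : Set (sphere (0 : Plane) 1)) (hs : MeasurableSet s) :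
    volume (Ioo (0 : ℝ) 1 • ((↑) '' s : Set Plane)) =
      ∫⁻ q in polarCoord.target, ENNReal.ofReal q.1 *
          (Ioo (0 : ℝ) 1 • ((↑) '' s : Set Plane)).indicator 1 (q.1 • ang q.2) := by
  have hA := measurableSet_cone s hs
  have hmp := Complex.orthonormalBasisOneI.repr.measurePreserving
  rw [← lintegral_indicator_one hA, ← hmp.lintegral_comp (measurable_one.indicator hA),
    ← Complex.lintegral_comp_polarCoord_symm]
  refine lintegral_congr fun q => ?_
  rw [smul_eq_mul]
  congr 2
  ext i
  fin_cases i <;> simp [ang, Complex.polarCoord_symm_apply,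
    Complex.cos_ofReal_re, Complex.sin_ofReal_re]

lemma measurable_ang_sphere :
    Measurable (fun α => (⟨ang α, by simp⟩ : sphere (0 : Plane) 1)) :=
  Continuous.measurable (by fun_prop)

lemma circleMeasure_eq_map :
    circleMeasure = (volume.restrict (Ioo (-π) π)).map
      (fun α => (⟨ang α, by simp⟩ : sphere (0 : Plane) 1)) := by
  have hm := measurable_ang_sphere
  ext s hs
  rw [circleMeasure, Measure.toSphere_apply' _ hs, volume_cone_eq_lintegral s hs,
    Measure.map_apply hm hs, polarCoord_target, Measure.volume_eq_prod, ← Measure.prod_restrict]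
  have hcongr : ∀ᵐ q : ℝ × ℝ ∂((volume.restrict (Ioi (0 : ℝ))).prod
      (volume.restrict (Ioo (-π) π))),
      ENNReal.ofReal q.1 * (Ioo (0 : ℝ) 1 • ((↑) '' s : Set Plane)).indicator 1 (q.1 • ang q.2) =
      (Iio (1 : ℝ)).indicator (fun r => ENNReal.ofReal r) q.1 *
        ((fun α => (⟨ang α, by simp⟩ : sphere (0 : Plane) 1)) ⁻¹' s).indicator 1 q.2 := by
    rw [Measure.prod_restrict]
    filter_upwards [ae_restrict_mem (measurableSet_Ioi.prod measurableSet_Ioo)] with q hq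
    have := mem_cone_iff s hq.1 q.2
    by_cases h1 : q.1 < 1 <;> by_cases h2 : (⟨ang q.2, by simp⟩ : sphere (0 : Plane) 1) ∈ s <;>
      simp [indicator, this, h1, h2]
  rw [lintegral_congr_ae hcongr, lintegral_prod_mul, lintegral_indicator_one (hm hs),
    ← mul_assoc, lintegral_indicator measurableSet_Iio, Measure.restrict_restrict measurableSet_Iio]
  · have : ∫⁻ r in Iio (1 : ℝ) ∩ Ioi 0, ENNReal.ofReal r = ENNReal.ofReal (1 / 2) := by
      rw [Iio_inter_Ioi, Measure.restrict_congr_set Ioo_ae_eq_Ioc,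
        ← ofReal_integral_eq_lintegral_ofReal, ← intervalIntegral.integral_of_le zero_le_one]
      · simp
      · exact (intervalIntegral.intervalIntegrable_id (μ := volume) (a := 0) (b := 1)).1
      · filter_upwards [ae_restrict_mem measurableSet_Ioc] with y hy using hy.1.le
    have h2 : (2 : ℝ≥0∞) * ENNReal.ofReal (1 / 2) = 1 := by
      rw [← ENNReal.ofReal_ofNat, ← ENNReal.ofReal_mul (by norm_num)]
      norm_num
    rw [this]
    simp only [finrank_euclideanSpace, Fintype.card_fin, Nat.cast_ofNat, h2, one_mul]
  · exact (ENNReal.measurable_ofReal.indicator measurableSet_Iio).aemeasurable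
  · exact (measurable_one.indicator (hm hs)).aemeasurable

lemma integral_circleMeasure {φ : Plane → ℝ} (hφ : Continuous φ) :
    ∫ n, φ (n : Plane) ∂circleMeasure = ∫ α in -π..π, φ (ang α) := by
  rw [circleMeasure_eq_map, integral_map measurable_ang_sphere.aemeasurable,
    intervalIntegral.integral_of_le (by linarith [pi_pos]), integral_Ioc_eq_integral_Ioo]
  exact Continuous.aestronglyMeasurable (by fun_prop)

lemma integral_complex_polar {F : ℂ → ℝ} (hF : Continuous F) {b : ℝ} (hb : 0 ≤ b)
    (hFb : ∀ ζ, b ≤ ‖ζ‖ → F ζ = 0) :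
    ∫ ζ, F ζ = ∫ r in (0 : ℝ)..b, r * ∫ φ in -π..π, F (r * (cos φ + sin φ * Complex.I)) := by
  rw [← Complex.integral_comp_polarCoord_symm, polarCoord_target]
  have hc : Continuous fun q : ℝ × ℝ => q.1 • F (q.1 * (cos q.2 + sin q.2 * Complex.I)) := by
    fun_prop
  simp only [Complex.polarCoord_symm_apply]
  rw [setIntegral_eq_of_subset_of_forall_sdiff_eq_zero (s := Ioc 0 b ×ˢ Ioo (-π) π)
    (measurableSet_Ioi.prod measurableSet_Ioo) (prod_mono Ioc_subset_Ioi_self subset_rfl) _,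
    Measure.volume_eq_prod, setIntegral_prod, intervalIntegral.integral_of_le hb]
  · refine integral_congr_ae (Eventually.of_forall fun r => ?_)
    simp only [smul_eq_mul]
    rw [MeasureTheory.integral_const_mul, intervalIntegral.integral_of_le (by linarith [pi_pos]),
      integral_Ioc_eq_integral_Ioo]
  · exact (hc.continuousOn.integrableOn_compact (isCompact_Icc.prod isCompact_Icc)).mono_set
      (prod_mono Ioc_subset_Icc_self Ioo_subset_Icc_self)
  · rintro ⟨r, φ⟩ ⟨⟨hr, hφ⟩, hn⟩
    have hr' : 0 < r := hr
    have : b ≤ r := by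
      by_contra! h
      exact hn ⟨⟨hr', h.le⟩, hφ⟩
    simp only [smul_eq_mul]
    rw [hFb, mul_zero]
    rw [← Complex.polarCoord_symm_apply (r, φ), Complex.norm_polarCoord_symm, abs_of_pos hr']
    exact this

lemma intervalIntegral_swap_of_continuous {F : ℝ → ℝ → ℝ} (hF : Continuous (Function.uncurry F))
    (a b c d : ℝ) :
    ∫ s in a..b, ∫ t in c..d, F s t = ∫ t in c..d, ∫ s in a..b, F s t :=
  intervalIntegral_intervalIntegral_swap
    ((hF.continuousOn.integrableOn_compact (isCompact_uIcc.prod isCompact_uIcc)).mono_set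
      (prod_mono uIoc_subset_uIcc uIoc_subset_uIcc))

lemma ang_add_pi (α : ℝ) : ang (α + π) = -ang α := by
  ext i
  fin_cases i <;> simp [ang]

lemma lap2_eq_fderiv_fderiv {φ : Plane → ℝ} (hφ : ContDiff ℝ 2 φ) (w : Plane) :
    lap2 φ w = ∑ i : Fin 2, fderiv ℝ (fderiv ℝ φ) w (EuclideanSpace.single i (1 : ℝ))
      (EuclideanSpace.single i (1 : ℝ)) := by
  have h1 : DifferentiableAt ℝ (fderiv ℝ φ) w :=
    (hφ.fderiv_right (m := 1) (by norm_num)).differentiable (by norm_num) w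
  refine Finset.sum_congr rfl fun i _ => ?_
  rw [fderiv_clm_apply h1 (differentiableAt_const _)]
  simp

lemma lap2_eq_ang {φ : Plane → ℝ} (hφ : ContDiff ℝ 2 φ) (w : Plane) (α : ℝ) :
    lap2 φ w = fderiv ℝ (fderiv ℝ φ) w (ang α) (ang α) +
      fderiv ℝ (fderiv ℝ φ) w (ang (α + π / 2)) (ang (α + π / 2)) := by
  have e1 : ang α = cos α • EuclideanSpace.single 0 (1 : ℝ) +
      sin α • EuclideanSpace.single 1 (1 : ℝ) := by
    ext i; fin_cases i <;> simp [ang]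
  have e2 : ang (α + π / 2) = (-sin α) • EuclideanSpace.single 0 (1 : ℝ) +
      cos α • EuclideanSpace.single 1 (1 : ℝ) := by
    ext i; fin_cases i <;> simp [ang, cos_add_pi_div_two, sin_add_pi_div_two]
  rw [lap2_eq_fderiv_fderiv hφ, Fin.sum_univ_two, e1, e2]
  simp only [map_add, map_smul, add_apply, smul_apply, smul_eq_mul]
  linear_combination (-fderiv ℝ (fderiv ℝ φ) w (EuclideanSpace.single 0 1)
    (EuclideanSpace.single 0 1) - fderiv ℝ (fderiv ℝ φ) w (EuclideanSpace.single 1 1)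
    (EuclideanSpace.single 1 1)) * sin_sq_add_cos_sq α

lemma integral_fderiv_fderiv_ang_perp {φ : Plane → ℝ} (hφ : ContDiff ℝ 2 φ) (x : Plane) (r : ℝ) :
    ∫ α in -π..π, r * fderiv ℝ (fderiv ℝ φ) (x + r • ang α) (ang (α + π / 2)) (ang (α + π / 2)) =
      ∫ α in -π..π, fderiv ℝ φ (x + r • ang α) (ang α) := by
  have c1 : ContDiff ℝ 1 (fderiv ℝ φ) := hφ.fderiv_right (by norm_num)
  have c2 : Continuous (fderiv ℝ (fderiv ℝ φ)) := c1.continuous_fderiv (by norm_num)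
  have c1' := c1.continuous
  have hd : ∀ α, HasDerivAt (fun β => fderiv ℝ φ (x + r • ang β) (ang (β + π / 2)))
      (r * fderiv ℝ (fderiv ℝ φ) (x + r • ang α) (ang (α + π / 2)) (ang (α + π / 2)) -
        fderiv ℝ φ (x + r • ang α) (ang α)) α := by
    intro α
    have ha := (hasDerivAt_ang α).const_smul r |>.const_add x
    have hF := ((c1.differentiable (by norm_num) (x + r • ang α)).hasFDerivAt).comp_hasDerivAt α ha
    have hb : HasDerivAt (fun β => ang (β + π / 2)) (ang (α + π / 2 + π / 2)) α :=
      HasDerivAt.comp_add_const α (π / 2) (hasDerivAt_ang (α + π / 2))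
    refine (hF.clm_apply hb).congr_deriv ?_
    rw [add_assoc, add_halves, ang_add_pi]
    simp [sub_eq_add_neg]
  have hi := intervalIntegral.integral_eq_sub_of_hasDerivAt (a := -π) (b := π) (fun α _ => hd α)
    (Continuous.intervalIntegrable (by fun_prop) _ _)
  have hper : ∀ s, ang (π + s) = ang (-π + s) := fun s => by
    rw [← ang_periodic (-π + s)]; congr 1; ring
  have hper0 : ang π = ang (-π) := by simpa using hper 0
  rw [hper, hper0, sub_self, intervalIntegral.integral_sub] at hi
  · linarith
  all_goals exact Continuous.intervalIntegrable (by fun_prop) _ _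

/-- Divergence theorem for a gradient on a disc, in polar coordinates. -/
lemma integral_lap2_disc {φ : Plane → ℝ} (hφ : ContDiff ℝ 2 φ) (x : Plane) (R : ℝ) :
    ∫ r in (0 : ℝ)..R, r * ∫ α in -π..π, lap2 φ (x + r • ang α) =
      R * ∫ α in -π..π, fderiv ℝ φ (x + R • ang α) (ang α) := by
  have c1 : ContDiff ℝ 1 (fderiv ℝ φ) := hφ.fderiv_right (by norm_num)
  have c2 : Continuous (fderiv ℝ (fderiv ℝ φ)) := c1.continuous_fderiv (by norm_num)
  have c1' := c1.continuous
  have h1 : ∀ r : ℝ, r * ∫ α in -π..π, lap2 φ (x + r • ang α) =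
      ∫ α in -π..π, (r * fderiv ℝ (fderiv ℝ φ) (x + r • ang α) (ang α) (ang α) +
        fderiv ℝ φ (x + r • ang α) (ang α)) := by
    intro r
    rw [intervalIntegral.integral_add, ← integral_fderiv_fderiv_ang_perp hφ,
      ← intervalIntegral.integral_add, ← intervalIntegral.integral_const_mul]
    · refine intervalIntegral.integral_congr fun α _ => ?_
      simp only [lap2_eq_ang hφ _ α, mul_add]
    all_goals exact Continuous.intervalIntegrable (by fun_prop) _ _
  simp only [h1]
  rw [intervalIntegral_swap_of_continuous (by fun_prop), ← intervalIntegral.integral_const_mul]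
  refine intervalIntegral.integral_congr fun α _ => ?_
  have hd : ∀ r : ℝ, HasDerivAt (fun s => s * fderiv ℝ φ (x + s • ang α) (ang α))
      (r * fderiv ℝ (fderiv ℝ φ) (x + r • ang α) (ang α) (ang α) +
        fderiv ℝ φ (x + r • ang α) (ang α)) r := by
    intro r
    have ha := ((hasDerivAt_id r).smul_const (ang α)).const_add x
    have hF := ((c1.differentiable (by norm_num) (x + r • ang α)).hasFDerivAt).comp_hasDerivAt r ha
    refine ((hasDerivAt_id r).mul (hF.clm_apply (hasDerivAt_const r (ang α)))).congr_deriv ?_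
    simp [add_comm]
  rw [intervalIntegral.integral_eq_sub_of_hasDerivAt (fun r _ => hd r)
    (Continuous.intervalIntegrable (by fun_prop) _ _)]
  simp

lemma integral_radial_deriv {φ : Plane → ℝ} (hφ : ContDiff ℝ 1 φ) (x : Plane) (R : ℝ) :
    ∫ r in (0 : ℝ)..R, ∫ α in -π..π, fderiv ℝ φ (x + r • ang α) (ang α) =
      (∫ α in -π..π, φ (x + R • ang α)) - 2 * π * φ x := by
  have c1 := hφ.continuous_fderiv (by norm_num)
  have c0 := hφ.continuous
  rw [intervalIntegral_swap_of_continuous (by fun_prop)]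
  have hd : ∀ α r : ℝ, HasDerivAt (fun s => φ (x + s • ang α))
      (fderiv ℝ φ (x + r • ang α) (ang α)) r := by
    intro α r
    have ha := ((hasDerivAt_id r).smul_const (ang α)).const_add x
    refine (((hφ.differentiable (by norm_num) (x + r • ang α)).hasFDerivAt).comp_hasDerivAt r
      ha).congr_deriv ?_
    simp
  have h1 : ∀ α : ℝ, ∫ r in (0 : ℝ)..R, fderiv ℝ φ (x + r • ang α) (ang α) =
      φ (x + R • ang α) - φ x := by
    intro α
    rw [intervalIntegral.integral_eq_sub_of_hasDerivAt (fun r _ => hd α r)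
      (Continuous.intervalIntegrable (by fun_prop) _ _)]
    simp
  simp only [h1]
  rw [intervalIntegral.integral_sub (Continuous.intervalIntegrable (by fun_prop) _ _)
    intervalIntegrable_const, intervalIntegral.integral_const, smul_eq_mul]
  ring

lemma exists_smul_ang_add_smul_ang (y z φ : ℝ) : ∃ ψ : ℝ, ∀ α : ℝ,
    y • ang α + z • ang (α + φ) = ‖(y + z * (cos φ + sin φ * Complex.I) : ℂ)‖ • ang (α + ψ) := by
  set ζ : ℂ := y + z * (cos φ + sin φ * Complex.I)
  have hre : ‖ζ‖ * cos ζ.arg = y + z * cos φ := by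
    rw [Complex.norm_mul_cos_arg]; simp [ζ, Complex.cos_ofReal_re, Complex.sin_ofReal_re]
  have him : ‖ζ‖ * sin ζ.arg = z * sin φ := by
    rw [Complex.norm_mul_sin_arg]; simp [ζ, Complex.cos_ofReal_re, Complex.sin_ofReal_re]
  refine ⟨ζ.arg, fun α => ?_⟩
  ext i
  fin_cases i
  · simp [ang, cos_add]
    linear_combination -cos α * hre + sin α * him
  · simp [ang, sin_add]
    linear_combination -sin α * hre - cos α * him

/-- Integral of `ℓ (·, z)` over the circle of centre `x` and radius `r`. -/
def circInt (x : Plane) (ℓ : Plane × ℝ → ℝ) (z r : ℝ) : ℝ :=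
  ∫ α in -π..π, ℓ (x + r • ang α, z)

lemma continuous_circInt {x : Plane} {ℓ : Plane × ℝ → ℝ} (hℓ : Continuous ℓ) :
    Continuous (Function.uncurry (circInt x ℓ)) := by
  unfold circInt Function.uncurry
  exact intervalIntegral.continuous_parametric_intervalIntegral_of_continuous' (by fun_prop) _ _

/-- The product of two circle integrations, rewritten through the distance of two points. -/
lemma integral_integral_ang {x : Plane} {ℓ : Plane × ℝ → ℝ} (hℓ : Continuous ℓ) (y z t : ℝ) :
    ∫ α in -π..π, ∫ β in -π..π, ℓ (x + (y * t) • ang α + (z * t) • ang β, z) =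
      ∫ φ in -π..π, circInt x ℓ z (t * ‖(y + z * (cos φ + sin φ * Complex.I) : ℂ)‖) := by
  have hshift : ∀ (F : Plane → ℝ) (c : ℝ),
      ∫ α in -π..π, F (ang (α + c)) = ∫ α in -π..π, F (ang α) := by
    intro F c
    have hp : Function.Periodic (fun α => F (ang α)) (2 * π) := fun α => by
      simp only [ang_periodic α]
    rw [intervalIntegral.integral_comp_add_right (fun α => F (ang α)) c]
    have := hp.intervalIntegral_add_eq (-π + c) (-π)
    convert this using 2 <;> ring
  have h1 : ∀ α, ∫ β in -π..π, ℓ (x + (y * t) • ang α + (z * t) • ang β, z) =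
      ∫ φ in -π..π, ℓ (x + (y * t) • ang α + (z * t) • ang (α + φ), z) := by
    intro α
    rw [← hshift (fun v => ℓ (x + (y * t) • ang α + (z * t) • v, z)) α]
    simp only [add_comm α]
  simp only [h1]
  rw [intervalIntegral_swap_of_continuous (by fun_prop)]
  refine intervalIntegral.integral_congr fun φ _ => ?_
  obtain ⟨ψ, hψ⟩ := exists_smul_ang_add_smul_ang y z φ
  simp only [circInt]
  rw [← hshift (fun v => ℓ (x + (t * ‖(y + z * (cos φ + sin φ * Complex.I) : ℂ)‖) • v, z)) ψ]
  refine intervalIntegral.integral_congr fun α _ => ?_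
  simp only [mul_smul, ← hψ α, smul_add, smul_comm t, add_assoc]

lemma integral_polar_dist {B : ℝ → ℝ → ℝ} (hB : Continuous (Function.uncurry B)) {b : ℝ}
    (hb : 0 ≤ b) (hBb : ∀ z, b ≤ z → ∀ r, B z r = 0) (y : ℝ) {T : ℝ} (hT : 0 < T) :
    ∫ z in (0 : ℝ)..b, z * ∫ φ in -π..π, B z (T * ‖(y + z * (cos φ + sin φ * Complex.I) : ℂ)‖) =
      (T⁻¹) ^ 2 * ∫ η : ℂ, B ‖(T⁻¹ : ℝ) • η - y‖ ‖η‖ := by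
  have hc : Continuous fun ζ : ℂ => B ‖ζ‖ (T * ‖(y : ℂ) + ζ‖) :=
    hB.comp (f := fun ζ : ℂ => (‖ζ‖, T * ‖(y : ℂ) + ζ‖)) (by fun_prop)
  have h1 := integral_complex_polar hc hb (fun ζ hζ => hBb _ hζ _)
  have h2 : ∫ z in (0 : ℝ)..b, z * ∫ φ in -π..π,
        B z (T * ‖(y + z * (cos φ + sin φ * Complex.I) : ℂ)‖) =
      ∫ z in (0 : ℝ)..b, z * ∫ φ in -π..π, B ‖(z * (cos φ + sin φ * Complex.I) : ℂ)‖
        (T * ‖(y + z * (cos φ + sin φ * Complex.I) : ℂ)‖) := by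
    refine intervalIntegral.integral_congr fun z hz => ?_
    rw [uIcc_of_le hb] at hz
    have : ∀ φ : ℝ, ‖(z * (cos φ + sin φ * Complex.I) : ℂ)‖ = z := fun φ => by
      rw [← Complex.polarCoord_symm_apply (z, φ), Complex.norm_polarCoord_symm,
        abs_of_nonneg hz.1]
    simp only [this]
  rw [h2, ← h1]
  have h3 := Measure.integral_comp_smul (volume : Measure ℂ)
    (fun ξ : ℂ => B ‖ξ - y‖ (T * ‖ξ‖)) T⁻¹
  have h4 : ∫ ξ : ℂ, B ‖ξ - y‖ (T * ‖ξ‖) = ∫ ζ : ℂ, B ‖ζ‖ (T * ‖(y : ℂ) + ζ‖) := by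
    rw [← integral_sub_right_eq_self (fun ζ : ℂ => B ‖ζ‖ (T * ‖(y : ℂ) + ζ‖)) (y : ℂ)]
    simp
  have h5 : ∀ η : ℂ, T * ‖(T⁻¹ : ℝ) • η‖ = ‖η‖ := fun η => by
    rw [norm_smul, norm_inv, norm_of_nonneg hT.le, mul_inv_cancel_left₀ hT.ne']
  simp only [h5, Complex.finrank_real_complex] at h3
  rw [h3, h4, smul_eq_mul, abs_of_pos (by positivity), ← mul_assoc]
  field_simp

/-- The derivative of `h : ℝ² × ℝ → ℝ` in the direction `(v, 0)`. -/
def derivFst (v : Plane) (h : Plane × ℝ → ℝ) (q : Plane × ℝ) : ℝ :=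
  fderiv ℝ h q (v, 0)

lemma ContDiff.derivFst {h : Plane × ℝ → ℝ} (hh : ContDiff ℝ (⊤ : ℕ∞) h) (v : Plane) :
    ContDiff ℝ (⊤ : ℕ∞) (derivFst v h) :=
  (hh.fderiv_right (m := (⊤ : ℕ∞)) (by simp)).clm_apply contDiff_const

lemma support_derivFst_subset (v : Plane) (h : Plane × ℝ → ℝ) :
    Function.support (derivFst v h) ⊆ tsupport h := by
  intro q hq
  refine support_fderiv_subset ℝ (f := h) fun h0 => hq ?_
  simp [derivFst, h0]

lemma tsupport_derivFst_subset (v : Plane) (h : Plane × ℝ → ℝ) :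
    tsupport (derivFst v h) ⊆ tsupport h :=
  closure_minimal (support_derivFst_subset v h) (isClosed_tsupport h)

lemma fderiv_slice {h : Plane × ℝ → ℝ} (hh : Differentiable ℝ h) (z : ℝ) (w v : Plane) :
    fderiv ℝ (fun w => h (w, z)) w v = derivFst v h (w, z) := by
  have h1 : HasFDerivAt (fun w : Plane => (w, z)) (ContinuousLinearMap.inl ℝ Plane ℝ) w :=
    hasFDerivAt_prodMk_left (𝕜 := ℝ) w z
  have h2 := (hh (w, z)).hasFDerivAt.comp w h1
  have h3 := h2.fderiv
  rw [show (fun w => h (w, z)) = h ∘ fun w => (w, z) from rfl, h3]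
  simp [derivFst]

/-- The Laplacian of `h : ℝ² × ℝ → ℝ` in the first argument. -/
def lapFst (h : Plane × ℝ → ℝ) (q : Plane × ℝ) : ℝ :=
  ∑ i : Fin 2, derivFst (EuclideanSpace.single i 1) (derivFst (EuclideanSpace.single i 1) h) q

lemma lap2_slice {h : Plane × ℝ → ℝ} (hh : ContDiff ℝ (⊤ : ℕ∞) h) (z : ℝ) (w : Plane) :
    lap2 (fun w => h (w, z)) w = lapFst h (w, z) := by
  refine Finset.sum_congr rfl fun i _ => ?_
  simp only [fderiv_slice (hh.differentiable (by simp))]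
  exact fderiv_slice ((hh.derivFst _).differentiable (by simp)) z w _

lemma ContDiff.lapFst {h : Plane × ℝ → ℝ} (hh : ContDiff ℝ (⊤ : ℕ∞) h) :
    ContDiff ℝ (⊤ : ℕ∞) (lapFst h) :=
  ContDiff.sum fun _ _ => (hh.derivFst _).derivFst _

lemma lapFst_eq_zero {h : Plane × ℝ → ℝ} {q : Plane × ℝ} (hq : q ∉ tsupport h) :
    lapFst h q = 0 := by
  refine Finset.sum_eq_zero fun i _ => ?_
  by_contra hne
  exact hq (tsupport_derivFst_subset _ _ (support_derivFst_subset _ _ hne))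

lemma HasCompactSupport.lapFst {h : Plane × ℝ → ℝ} (hc : HasCompactSupport h) :
    HasCompactSupport (lapFst h) :=
  HasCompactSupport.intro hc fun _ hq => lapFst_eq_zero hq

lemma hasFDerivAt_intervalIntegral {F : ℝ → Plane → ℝ} {F' : ℝ → Plane → Plane →L[ℝ] ℝ}
    (hF : Continuous (Function.uncurry F)) (hF' : Continuous (Function.uncurry F'))
    (hd : ∀ t u, HasFDerivAt (F t) (F' t u) u) (a b : ℝ) (u : Plane) :
    HasFDerivAt (fun u => ∫ t in a..b, F t u) (∫ t in a..b, F' t u) u := by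
  obtain ⟨C, hC⟩ := (isCompact_uIcc (a := a) (b := b)).prod
    (isCompact_closedBall u 1) |>.exists_bound_of_continuousOn hF'.continuousOn
  refine intervalIntegral.hasFDerivAt_integral_of_dominated_of_fderiv_le (𝕜 := ℝ)
    (F := fun u t => F t u) (F' := fun u t => F' t u) (x₀ := u) (s := closedBall u 1)
    (μ := volume) (a := a) (b := b) (bound := fun _ => C)
    (closedBall_mem_nhds u one_pos) (Eventually.of_forall fun w => ?_) ?_ ?_ ?_ ?_ ?_
  · exact Continuous.aestronglyMeasurable (by fun_prop)
  · exact Continuous.intervalIntegrable (by fun_prop) _ _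
  · exact Continuous.aestronglyMeasurable (by fun_prop)
  · exact Eventually.of_forall fun t ht w hw => hC (t, w) ⟨uIoc_subset_uIcc ht, hw⟩
  · exact intervalIntegrable_const
  · exact Eventually.of_forall fun t _ w _ => hd t w

/-- Integral of `h` over the (truncated) cone with vertex `(u, 0)` and slope `t`. -/
def coneInt (b : ℝ) (h : Plane × ℝ → ℝ) (t : ℝ) (u : Plane) : ℝ :=
  ∫ z in (0 : ℝ)..b, z * ∫ β in -π..π, h (u + (z * t) • ang β, z)

lemma continuous_coneInt {b : ℝ} {h : Plane × ℝ → ℝ} (hh : Continuous h) :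
    Continuous (Function.uncurry (coneInt b h)) := by
  unfold coneInt Function.uncurry
  refine intervalIntegral.continuous_parametric_intervalIntegral_of_continuous' ?_ _ _
  refine continuous_snd.mul (f := fun q : (ℝ × Plane) × ℝ => q.2) ?_
  exact intervalIntegral.continuous_parametric_intervalIntegral_of_continuous'
    (f := fun (q : (ℝ × Plane) × ℝ) β => h (q.1.2 + (q.2 * q.1.1) • ang β, q.2))
    (by fun_prop) _ _

lemma fderiv_coneInt {b : ℝ} {h : Plane × ℝ → ℝ} (hh : ContDiff ℝ (⊤ : ℕ∞) h) (t : ℝ)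
    (u v : Plane) : fderiv ℝ (coneInt b h t) u v = coneInt b (derivFst v h) t u := by
  have hc := hh.continuous
  have hc' : Continuous (fderiv ℝ h) := hh.continuous_fderiv (by simp)
  have hin : ∀ z u, HasFDerivAt (fun u => ∫ β in -π..π, h (u + (z * t) • ang β, z))
      (∫ β in -π..π, (fderiv ℝ h (u + (z * t) • ang β, z)).comp
        (ContinuousLinearMap.inl ℝ Plane ℝ)) u := by
    intro z u
    refine hasFDerivAt_intervalIntegral (F := fun β u => h (u + (z * t) • ang β, z))
      (F' := fun β u => (fderiv ℝ h (u + (z * t) • ang β, z)).comp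
        (ContinuousLinearMap.inl ℝ Plane ℝ)) (by fun_prop) (by fun_prop) (fun β u => ?_) _ _ u
    have h1 : HasFDerivAt (fun u : Plane => (u + (z * t) • ang β, z))
        (ContinuousLinearMap.inl ℝ Plane ℝ) u :=
      ((hasFDerivAt_id u).add_const _).prodMk (hasFDerivAt_const z u)
    exact (hh.differentiable (by simp) _).hasFDerivAt.comp u h1
  have hout := hasFDerivAt_intervalIntegral
    (F := fun z u => z * ∫ β in -π..π, h (u + (z * t) • ang β, z))
    (F' := fun z u => z • ∫ β in -π..π, (fderiv ℝ h (u + (z * t) • ang β, z)).comp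
        (ContinuousLinearMap.inl ℝ Plane ℝ)) ?_ ?_ (fun z u => (hin z u).const_mul z) 0 b u
  · unfold coneInt
    rw [hout.fderiv, ContinuousLinearMap.intervalIntegral_apply]
    · refine intervalIntegral.integral_congr fun z _ => ?_
      simp only [smul_apply, smul_eq_mul]
      rw [ContinuousLinearMap.intervalIntegral_apply]
      · simp [derivFst]
      · exact Continuous.intervalIntegrable (by fun_prop) _ _
    · refine Continuous.intervalIntegrable ?_ _ _
      refine continuous_id.smul ?_
      exact intervalIntegral.continuous_parametric_intervalIntegral_of_continuous'
        (by fun_prop) _ _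
  · refine continuous_fst.mul ?_
    exact intervalIntegral.continuous_parametric_intervalIntegral_of_continuous'
      (f := fun (q : ℝ × Plane) β => h (q.2 + (q.1 * t) • ang β, q.1)) (by fun_prop) _ _
  · refine continuous_fst.smul ?_
    exact intervalIntegral.continuous_parametric_intervalIntegral_of_continuous'
      (f := fun (q : ℝ × Plane) β => (fderiv ℝ h (q.2 + (q.1 * t) • ang β, q.1)).comp
        (ContinuousLinearMap.inl ℝ Plane ℝ)) (by fun_prop) _ _

lemma lap2_coneInt {b : ℝ} {h : Plane × ℝ → ℝ} (hh : ContDiff ℝ (⊤ : ℕ∞) h) (t : ℝ)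
    (u : Plane) : lap2 (coneInt b h t) u = coneInt b (lapFst h) t u := by
  have hsum : ∀ (g₁ g₂ : Plane × ℝ → ℝ), Continuous g₁ → Continuous g₂ →
      coneInt b (fun q => g₁ q + g₂ q) t u = coneInt b g₁ t u + coneInt b g₂ t u := by
    intro g₁ g₂ h₁ h₂
    have hcont : ∀ g : Plane × ℝ → ℝ, Continuous g →
        Continuous fun z => z * ∫ β in -π..π, g (u + (z * t) • ang β, z) := fun g hg =>
      continuous_id.mul (intervalIntegral.continuous_parametric_intervalIntegral_of_continuous'
        (by fun_prop) _ _)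
    unfold coneInt
    rw [← intervalIntegral.integral_add ((hcont g₁ h₁).intervalIntegrable _ _)
      ((hcont g₂ h₂).intervalIntegrable _ _)]
    refine intervalIntegral.integral_congr fun z _ => ?_
    simp only
    rw [intervalIntegral.integral_add, mul_add]
    all_goals exact Continuous.intervalIntegrable (by fun_prop) _ _
  unfold lap2 lapFst
  simp only [Fin.sum_univ_two, fderiv_coneInt hh]
  rw [hsum _ _ ((hh.derivFst _).derivFst _).continuous ((hh.derivFst _).derivFst _).continuous,
    ← fderiv_coneInt (hh.derivFst _), ← fderiv_coneInt (hh.derivFst _)]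

/-- The mean of `circInt x ℓ z` over radii in `[0, r]`, with weight proportional to the radius. -/
def discMean (x : Plane) (ℓ : Plane × ℝ → ℝ) (z r : ℝ) : ℝ :=
  ∫ τ in (0 : ℝ)..1, τ * circInt x ℓ z (r * τ)

section Kernel

variable {x : Plane} {ℓ : Plane × ℝ → ℝ} {b : ℝ}

lemma continuous_discMean (hℓ : Continuous ℓ) :
    Continuous (Function.uncurry (discMean x ℓ)) := by
  have hG := continuous_circInt (x := x) hℓ
  unfold discMean
  refine intervalIntegral.continuous_parametric_intervalIntegral_of_continuous'
    (f := fun (q : ℝ × ℝ) τ => τ * circInt x ℓ q.1 (q.2 * τ)) ?_ _ _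
  exact continuous_snd.mul (hG.comp (f := fun p : (ℝ × ℝ) × ℝ => (p.1.1, p.1.2 * p.2))
    (by fun_prop))

lemma sq_mul_discMean (z r : ℝ) (c : ℝ) :
    r ^ 2 * discMean x ℓ z (r * c) = ∫ s in (0 : ℝ)..r, s * circInt x ℓ z (s * c) := by
  have h := intervalIntegral.mul_integral_comp_mul_left (a := 0) (b := 1)
    (f := fun s => s * circInt x ℓ z (s * c)) r
  rw [mul_zero, mul_one] at h
  rw [← h, discMean, sq, mul_assoc, ← intervalIntegral.integral_const_mul]
  congr 1
  refine intervalIntegral.integral_congr fun τ _ => ?_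
  simp only [mul_right_comm r c τ]
  ring

lemma circInt_eq_zero {z r : ℝ} (h : ∀ w, ‖w‖ = |r| → ℓ (x + w, z) = 0) : circInt x ℓ z r = 0 := by
  have : ∀ α, ℓ (x + r • ang α, z) = 0 := fun α => h _ (by simp [norm_smul])
  simp [circInt, this]

lemma abs_circInt_sub_le {C : NNReal} (hℓ : LipschitzWith C ℓ) (z z' r : ℝ) :
    |circInt x ℓ z r - circInt x ℓ z' r| ≤ 2 * π * C * |z - z'| := by
  have hc := hℓ.continuous
  unfold circInt
  rw [← intervalIntegral.integral_sub, ← Real.norm_eq_abs]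
  · refine (intervalIntegral.norm_integral_le_of_norm_le_const (C := C * |z - z'|)
      fun α _ => ?_).trans (le_of_eq ?_)
    · have := hℓ.dist_le_mul (x + r • ang α, z) (x + r • ang α, z')
      simpa [Real.dist_eq, Prod.dist_eq] using this
    · rw [abs_of_pos (a := π - -π) (by linarith [pi_pos])]; ring
  all_goals exact Continuous.intervalIntegrable (by fun_prop) _ _

lemma abs_circInt_le {C : ℝ} (hℓ : ∀ q, |ℓ q| ≤ C) (z r : ℝ) :
    |circInt x ℓ z r| ≤ 2 * π * C := by
  refine (intervalIntegral.norm_integral_le_of_norm_le_const (C := C)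
      (f := fun α => ℓ (x + r • ang α, z)) fun α _ => hℓ (x + r • ang α, z)).trans (le_of_eq ?_)
  rw [abs_of_pos (a := π - -π) (by linarith [pi_pos])]; ring

lemma abs_discMean_le {C : ℝ} (hℓ : ∀ q, |ℓ q| ≤ C) (z r : ℝ) :
    |discMean x ℓ z r| ≤ 2 * π * C := by
  have h : ∀ τ ∈ uIoc (0 : ℝ) 1, ‖τ * circInt x ℓ z (r * τ)‖ ≤ 2 * π * C := fun τ hτ => ?_
  · simpa [discMean] using intervalIntegral.norm_integral_le_of_norm_le_const h
  rw [uIoc_of_le zero_le_one] at hτ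
  rw [norm_mul, Real.norm_eq_abs, Real.norm_eq_abs, abs_of_pos hτ.1]
  exact (mul_le_of_le_one_left (abs_nonneg _) hτ.2).trans (abs_circInt_le hℓ _ _)

/-- The circular mean around `x` of the cone integrals, at slope `t`. -/
def coneMean (b : ℝ) (ℓ : Plane × ℝ → ℝ) (x : Plane) (y t : ℝ) : ℝ :=
  ∫ α in -π..π, coneInt b ℓ t (x + (y * t) • ang α)

lemma continuous_coneMean (hℓ : Continuous ℓ) (y : ℝ) : Continuous (coneMean b ℓ x y) := by
  unfold coneMean
  refine intervalIntegral.continuous_parametric_intervalIntegral_of_continuous' ?_ _ _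
  exact (continuous_coneInt (b := b) hℓ).comp
    (f := fun q : ℝ × ℝ => (q.1, x + (y * q.1) • ang q.2)) (by fun_prop)

lemma coneMean_eq (hℓ : Continuous ℓ) (y t : ℝ) :
    coneMean b ℓ x y t = ∫ z in (0 : ℝ)..b, z *
      ∫ φ in -π..π, circInt x ℓ z (t * ‖(y + z * (cos φ + sin φ * Complex.I) : ℂ)‖) := by
  unfold coneMean coneInt
  rw [intervalIntegral_swap_of_continuous]
  · refine intervalIntegral.integral_congr fun z _ => ?_
    simp only [intervalIntegral.integral_const_mul, integral_integral_ang hℓ]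
  · refine continuous_snd.mul ?_
    exact intervalIntegral.continuous_parametric_intervalIntegral_of_continuous'
      (f := fun (q : ℝ × ℝ) β => ℓ (x + (y * t) • ang q.1 + (q.2 * t) • ang β, q.2))
      (by fun_prop) _ _

variable (hℓ : Continuous ℓ) (hb : 0 ≤ b) (hℓb : ∀ w z, b ≤ z → ℓ (w, z) = 0)
include hℓ hb hℓb

lemma coneMean_eq_integral_complex (y : ℝ) {t : ℝ} (ht : 0 < t) :
    coneMean b ℓ x y t = (t⁻¹) ^ 2 * ∫ η : ℂ, circInt x ℓ ‖(t⁻¹ : ℝ) • η - y‖ ‖η‖ := by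
  rw [coneMean_eq hℓ, integral_polar_dist (continuous_circInt hℓ) hb _ y ht]
  exact fun z hz r => circInt_eq_zero fun w _ => hℓb _ _ hz

lemma integral_coneMean_eq_integral_complex (y : ℝ) {T : ℝ} (hT : 0 < T) :
    ∫ t in (0 : ℝ)..T, t * coneMean b ℓ x y t =
      ∫ η : ℂ, discMean x ℓ ‖(T⁻¹ : ℝ) • η - y‖ ‖η‖ := by
  have hG := continuous_circInt (x := x) hℓ
  have h0 := integral_polar_dist (continuous_discMean (x := x) hℓ) hb (fun z hz r => by
    have : ∀ s, circInt x ℓ z s = 0 := fun s => circInt_eq_zero fun w _ => hℓb _ _ hz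
    simp [discMean, this]) y hT
  have h1 : ∫ t in (0 : ℝ)..T, t * coneMean b ℓ x y t =
      T ^ 2 * ∫ z in (0 : ℝ)..b, z * ∫ φ in -π..π,
        discMean x ℓ z (T * ‖(y + z * (cos φ + sin φ * Complex.I) : ℂ)‖) := by
    have hGc : Continuous fun q : (ℝ × ℝ) × ℝ =>
        circInt x ℓ q.1.2 (q.1.1 * ‖(y + q.1.2 * (cos q.2 + sin q.2 * Complex.I) : ℂ)‖) :=
      hG.comp (f := fun q : (ℝ × ℝ) × ℝ =>
        (q.1.2, q.1.1 * ‖(y + q.1.2 * (cos q.2 + sin q.2 * Complex.I) : ℂ)‖)) (by fun_prop)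
    simp only [coneMean_eq hℓ, ← intervalIntegral.integral_const_mul]
    rw [intervalIntegral_swap_of_continuous]
    · refine intervalIntegral.integral_congr fun z _ => ?_
      rw [intervalIntegral_swap_of_continuous]
      · refine intervalIntegral.integral_congr fun φ _ => ?_
        rw [mul_left_comm, sq_mul_discMean, ← intervalIntegral.integral_const_mul]
        refine intervalIntegral.integral_congr fun t _ => ?_
        ring
      · refine continuous_fst.mul (continuous_const.mul ?_)
        exact hGc.comp (f := fun q : ℝ × ℝ => ((q.1, z), q.2)) (by fun_prop)
    · refine intervalIntegral.continuous_parametric_intervalIntegral_of_continuous'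
        (f := fun (q : ℝ × ℝ) φ => q.1 * (q.2 *
          circInt x ℓ q.2 (q.1 * ‖(y + q.2 * (cos φ + sin φ * Complex.I) : ℂ)‖))) ?_ _ _
      exact (continuous_fst.comp continuous_fst).mul
        ((continuous_snd.comp continuous_fst).mul hGc)
  rw [h1, h0, ← mul_assoc, ← mul_pow, mul_inv_cancel₀ hT.ne', one_pow, one_mul]

end Kernel

lemma integral_complex_radial {g : ℝ → ℝ} (hg : Continuous g) {R : ℝ} (hR : 0 ≤ R)
    (hgR : ∀ r, R ≤ r → g r = 0) :
    ∫ η : ℂ, g ‖η‖ = 2 * π * ∫ r in (0 : ℝ)..R, r * g r := by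
  rw [integral_complex_polar (F := fun η => g ‖η‖) (by fun_prop) hR fun ζ h => hgR _ h,
    ← intervalIntegral.integral_const_mul]
  refine intervalIntegral.integral_congr fun r hr => ?_
  rw [uIcc_of_le hR] at hr
  have : ∀ φ : ℝ, ‖(r * (cos φ + sin φ * Complex.I) : ℂ)‖ = r := fun φ => by
    rw [← Complex.polarCoord_symm_apply (r, φ), Complex.norm_polarCoord_symm,
      abs_of_nonneg hr.1]
  simp only [this, intervalIntegral.integral_const, smul_eq_mul]
  ring

lemma circInt_lapFst_eq_zero {h : Plane × ℝ → ℝ} {x : Plane} {R : ℝ} (hR : 0 < R)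
    (hhR : ∀ w z, R ≤ ‖w‖ → (x + w, z) ∉ tsupport h) (z : ℝ) {r : ℝ} (hr : R ≤ r) :
    circInt x (lapFst h) z r = 0 :=
  circInt_eq_zero fun w hw => lapFst_eq_zero <| hhR w z <| by
    rw [hw, abs_of_pos (hR.trans_le hr)]; exact hr

section Inversion

variable {h : Plane × ℝ → ℝ} (hh : ContDiff ℝ (⊤ : ℕ∞) h) (x : Plane)
include hh

lemma contDiff_slice (z : ℝ) : ContDiff ℝ (⊤ : ℕ∞) fun w => h (w, z) :=
  hh.comp (contDiff_id.prodMk contDiff_const)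

lemma integral_circInt_lapFst (z R : ℝ) :
    ∫ r in (0 : ℝ)..R, r * circInt x (lapFst h) z r =
      R * ∫ α in -π..π, fderiv ℝ (fun w => h (w, z)) (x + R • ang α) (ang α) := by
  rw [← integral_lap2_disc ((contDiff_slice hh z).of_le (by norm_cast))]
  simp only [lap2_slice hh, circInt]

lemma mul_discMean_lapFst (z : ℝ) {r : ℝ} (hr : r ≠ 0) :
    r * discMean x (lapFst h) z r =
      ∫ α in -π..π, fderiv ℝ (fun w => h (w, z)) (x + r • ang α) (ang α) := by
  have h1 := sq_mul_discMean (x := x) (ℓ := lapFst h) z r 1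
  simp only [mul_one] at h1
  rw [integral_circInt_lapFst hh, sq, mul_assoc] at h1
  exact mul_left_cancel₀ hr h1

variable {R : ℝ} (hR : 0 < R) (hhR : ∀ w z, R ≤ ‖w‖ → (x + w, z) ∉ tsupport h)
include hR hhR

lemma circular_deriv_eq_zero (z : ℝ) {r : ℝ} (hr : R ≤ r) :
    ∫ α in -π..π, fderiv ℝ (fun w => h (w, z)) (x + r • ang α) (ang α) = 0 := by
  have : ∀ α, fderiv ℝ (fun w => h (w, z)) (x + r • ang α) (ang α) = 0 := by
    intro α
    rw [fderiv_slice (hh.differentiable (by simp))]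
    by_contra hne
    refine hhR (r • ang α) z ?_ (support_derivFst_subset _ _ hne)
    rwa [norm_smul, norm_ang, mul_one, norm_of_nonneg (hR.le.trans hr)]
  simp [this]

lemma discMean_lapFst_eq_zero (z : ℝ) {r : ℝ} (hr : R ≤ r) : discMean x (lapFst h) z r = 0 := by
  have hr0 : r ≠ 0 := (hR.trans_le hr).ne'
  have h1 := mul_discMean_lapFst hh x z hr0
  rw [circular_deriv_eq_zero hh x hR hhR z hr] at h1
  exact (mul_eq_zero.1 h1).resolve_left hr0

lemma integral_complex_circInt_lapFst (z : ℝ) : ∫ η : ℂ, circInt x (lapFst h) z ‖η‖ = 0 := by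
  have hc : Continuous (circInt x (lapFst h) z) :=
    (continuous_circInt hh.lapFst.continuous).comp (f := fun r => (z, r)) (by fun_prop)
  rw [integral_complex_radial hc hR.le fun r hr => circInt_lapFst_eq_zero hR hhR z hr,
    integral_circInt_lapFst hh, circular_deriv_eq_zero hh x hR hhR z le_rfl]
  simp

lemma integral_complex_discMean_lapFst (z : ℝ) :
    ∫ η : ℂ, discMean x (lapFst h) z ‖η‖ = -(4 * π ^ 2) * h (x, z) := by
  have hc : Continuous (discMean x (lapFst h) z) :=
    (continuous_discMean hh.lapFst.continuous).comp (f := fun r => (z, r)) (by fun_prop)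
  have h1 : ∫ r in (0 : ℝ)..R, r * discMean x (lapFst h) z r = ∫ r in (0 : ℝ)..R,
      ∫ α in -π..π, fderiv ℝ (fun w => h (w, z)) (x + r • ang α) (ang α) := by
    simp only [intervalIntegral.integral_of_le hR.le]
    exact setIntegral_congr_fun measurableSet_Ioc fun r hr => mul_discMean_lapFst hh x z hr.1.ne'
  have h2 : ∀ α, h (x + R • ang α, z) = 0 := fun α => by
    by_contra hne
    refine hhR (R • ang α) z ?_ (subset_tsupport _ hne)
    rw [norm_smul, norm_ang, mul_one, norm_of_nonneg hR.le]
  rw [integral_complex_radial hc hR.le fun r hr => discMean_lapFst_eq_zero hh x hR hhR z hr, h1,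
    integral_radial_deriv ((contDiff_slice hh z).of_le (by norm_cast))]
  simp only [h2, intervalIntegral.integral_zero]
  ring

variable (hc : HasCompactSupport h) {b : ℝ} (hb : 0 ≤ b)
  (hhb : ∀ w z, b ≤ z → (w, z) ∉ tsupport h)
include hc hb hhb

lemma exists_coneMean_le (y : ℝ) :
    ∃ C : ℝ, ∀ t > 0, |coneMean b (lapFst h) x y t| ≤ C * (t⁻¹) ^ 3 := by
  have hℓ := hh.lapFst.continuous
  have hG := continuous_circInt (x := x) hℓ
  obtain ⟨L, hL⟩ := hh.lapFst.lipschitzWith_of_hasCompactSupport hc.lapFst (by simp)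
  have hbz : ∀ w z, b ≤ z → lapFst h (w, z) = 0 := fun w z hz => lapFst_eq_zero (hhb w z hz)
  refine ⟨2 * π * L * R * volume.real (closedBall (0 : ℂ) R), fun t ht => ?_⟩
  have hsub : ∀ u : ℂ → ℝ, Continuous u →
      IntegrableOn (fun η : ℂ => circInt x (lapFst h) (u η) ‖η‖) (closedBall (0 : ℂ) R) ∧
      ∫ η : ℂ, circInt x (lapFst h) (u η) ‖η‖ =
        ∫ η in closedBall (0 : ℂ) R, circInt x (lapFst h) (u η) ‖η‖ := fun u hu => by
    refine ⟨(hG.comp (f := fun η : ℂ => (u η, ‖η‖)) (by fun_prop)).continuousOn.integrableOn_compact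
      (isCompact_closedBall _ _), (setIntegral_eq_integral_of_forall_compl_eq_zero
        fun η hη => ?_).symm⟩
    exact circInt_lapFst_eq_zero hR hhR _ (not_le.1 fun hle => hη (by simpa using hle)).le
  obtain ⟨hi₁, he₁⟩ := hsub (fun η => ‖(t⁻¹ : ℝ) • η - y‖) (by fun_prop)
  obtain ⟨hi₂, he₂⟩ := hsub (fun _ => |y|) (by fun_prop)
  rw [integral_complex_circInt_lapFst hh x hR hhR] at he₂
  rw [coneMean_eq_integral_complex hℓ hb hbz y ht, he₁,
    ← sub_zero (∫ η in closedBall (0 : ℂ) R, _), he₂, ← integral_sub hi₁ hi₂, abs_mul,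
    abs_of_nonneg (sq_nonneg t⁻¹)]
  have hpt : ∀ η ∈ closedBall (0 : ℂ) R, ‖circInt x (lapFst h) ‖(t⁻¹ : ℝ) • η - y‖ ‖η‖ -
      circInt x (lapFst h) |y| ‖η‖‖ ≤ 2 * π * L * (t⁻¹ * R) := fun η hη => by
    refine (abs_circInt_sub_le hL _ _ _).trans (mul_le_mul_of_nonneg_left ?_ (by positivity))
    have h1 := abs_norm_sub_norm_le ((t⁻¹ : ℝ) • η - y) (-(y : ℂ))
    rw [sub_neg_eq_add, sub_add_cancel, norm_neg, Complex.norm_real, norm_smul,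
      norm_of_nonneg (inv_pos.2 ht).le, Real.norm_eq_abs] at h1
    exact h1.trans (mul_le_mul_of_nonneg_left (by simpa using hη) (inv_pos.2 ht).le)
  have h2 := norm_setIntegral_le_of_norm_le_const (μ := volume) measure_closedBall_lt_top hpt
  rw [Real.norm_eq_abs] at h2
  refine (mul_le_mul_of_nonneg_left h2 (sq_nonneg t⁻¹)).trans (le_of_eq ?_)
  ring

lemma tendsto_integral_coneMean {y : ℝ} (hy : 0 < y) :
    Tendsto (fun T => ∫ t in (0 : ℝ)..T, t * coneMean b (lapFst h) x y t) atTop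
      (𝓝 (-(4 * π ^ 2) * h (x, y))) := by
  have hℓ := hh.lapFst.continuous
  have hH := continuous_discMean (x := x) hℓ
  obtain ⟨C, hC⟩ : ∃ C, ∀ q, |lapFst h q| ≤ C := hc.lapFst.exists_bound_of_continuous hℓ
  rw [← integral_complex_discMean_lapFst hh x hR hhR y]
  have hev : (fun T => ∫ η : ℂ, discMean x (lapFst h) ‖(T⁻¹ : ℝ) • η - y‖ ‖η‖) =ᶠ[atTop]
      fun T => ∫ t in (0 : ℝ)..T, t * coneMean b (lapFst h) x y t := by
    filter_upwards [eventually_gt_atTop 0] with T hT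
    exact (integral_coneMean_eq_integral_complex hℓ hb
      (fun w z hz => lapFst_eq_zero (hhb w z hz)) y hT).symm
  refine Tendsto.congr' hev ?_
  refine tendsto_integral_filter_of_dominated_convergence
    ((closedBall (0 : ℂ) R).indicator fun _ => 2 * π * C) ?_ ?_ ?_ ?_
  · refine Eventually.of_forall fun T => Continuous.aestronglyMeasurable ?_
    exact hH.comp (f := fun η : ℂ => (‖(T⁻¹ : ℝ) • η - y‖, ‖η‖)) (by fun_prop)
  · refine Eventually.of_forall fun T => Eventually.of_forall fun η => ?_
    by_cases hη : η ∈ closedBall (0 : ℂ) R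
    · rw [indicator_of_mem hη, Real.norm_eq_abs]
      exact abs_discMean_le (x := x) hC ‖(T⁻¹ : ℝ) • η - y‖ ‖η‖
    · rw [indicator_of_notMem hη, discMean_lapFst_eq_zero hh x hR hhR, norm_zero]
      simpa using (not_le.1 fun hle => hη (by simpa using hle)).le
  · rw [integrable_indicator_iff measurableSet_closedBall]
    exact integrableOn_const (measure_closedBall_lt_top.ne)
  · refine Eventually.of_forall fun η => ?_
    have h1 : Tendsto (fun T : ℝ => (‖(T⁻¹ : ℝ) • η - y‖, ‖η‖)) atTop (𝓝 (y, ‖η‖)) := by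
      refine Tendsto.prodMk_nhds ?_ tendsto_const_nhds
      have := ((tendsto_inv_atTop_zero (𝕜 := ℝ)).smul_const η).sub_const (y : ℂ) |>.norm
      simpa [abs_of_pos hy] using this
    have h2 : Tendsto (fun q : ℝ × ℝ => discMean x (lapFst h) q.1 q.2) (𝓝 (y, ‖η‖))
        (𝓝 (discMean x (lapFst h) y ‖η‖)) := hH.tendsto (y, ‖η‖)
    have h3 := h2.comp h1
    exact h3

lemma integral_Ioi_coneMean {y : ℝ} (hy : 0 < y) :
    ∫ t in Ioi (0 : ℝ), t * coneMean b (lapFst h) x y t = -(4 * π ^ 2) * h (x, y) := by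
  have hK : Continuous fun t => t * coneMean b (lapFst h) x y t :=
    continuous_id.mul (continuous_coneMean hh.lapFst.continuous y)
  obtain ⟨C, hC⟩ := exists_coneMean_le hh x hR hhR hc hb hhb y
  have hint : IntegrableOn (fun t => t * coneMean b (lapFst h) x y t) (Ioi 0) := by
    rw [← Ioc_union_Ioi_eq_Ioi zero_le_one]
    refine (hK.integrableOn_Ioc).union ?_
    refine Integrable.mono' (((integrableOn_Ioi_rpow_of_lt (a := -2) (by norm_num)
      one_pos).const_mul C)) hK.aestronglyMeasurable ?_
    refine (ae_restrict_iff' measurableSet_Ioi).2 (Eventually.of_forall fun t ht => ?_)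
    have ht0 : (0 : ℝ) < t := one_pos.trans ht
    rw [norm_mul, norm_of_nonneg ht0.le, Real.norm_eq_abs]
    refine (mul_le_mul_of_nonneg_left (hC t ht0) ht0.le).trans (le_of_eq ?_)
    rw [rpow_neg ht0.le, rpow_two]
    field_simp
  exact tendsto_nhds_unique (intervalIntegral_tendsto_integral_Ioi 0 hint tendsto_id)
    (tendsto_integral_coneMean hh x hR hhR hc hb hhb hy)

end Inversion

/-- The function `f` multiplied by the power `-p` of its last variable. -/
def weighted (p : ℝ) (f : Plane × ℝ → ℝ) (q : Plane × ℝ) : ℝ :=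
  q.2 ^ (-p) * f q

section Weighted

variable {p : ℝ} {f : Plane × ℝ → ℝ}

lemma tsupport_weighted_subset : tsupport (weighted p f) ⊆ tsupport f :=
  closure_mono fun _ hq => right_ne_zero_of_mul hq

lemma HasCompactSupport.weighted (hfc : HasCompactSupport f) :
    HasCompactSupport (weighted p f) :=
  HasCompactSupport.mul_left hfc

lemma contDiff_weighted (hf : ContDiff ℝ (⊤ : ℕ∞) f)
    (hfs : tsupport f ⊆ {q : Plane × ℝ | 0 < q.2}) :
    ContDiff ℝ (⊤ : ℕ∞) (weighted p f) := by
  refine contDiff_iff_contDiffAt.2 fun q => ?_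
  by_cases hq : q ∈ tsupport (weighted p f)
  swap
  · exact contDiffAt_const.congr_of_eventuallyEq (notMem_tsupport_iff_eventuallyEq.1 hq)
  have hq0 : 0 < q.2 := hfs (tsupport_weighted_subset hq)
  exact (contDiffAt_snd.rpow_const_of_ne hq0.ne').mul hf.contDiffAt

lemma weighted_mul_rpow {q : Plane × ℝ} (hq : 0 < q.2) : q.2 ^ p * weighted p f q = f q := by
  rw [weighted, ← mul_assoc, ← rpow_add hq, add_neg_cancel, rpow_zero, one_mul]

end Weighted

lemma coneRadon3_eq {p : ℝ} {f : Plane × ℝ → ℝ} (hf : Continuous f) {b : ℝ} (hb : 0 ≤ b)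
    (hfb : ∀ w z, b ≤ z → (w, z) ∉ tsupport f) {θ : ℝ} (hθ : 0 < cos θ) (u : Plane) :
    coneRadon3 p f u θ =
      (cos θ ^ p * (cos θ)⁻¹ * tan θ) * coneInt b (weighted p f) (tan θ) u := by
  set g : ℝ → ℝ := fun z => cos θ ^ p * tan θ *
    (z * ∫ β in -π..π, weighted p f (u + (z * tan θ) • ang β, z)) with hg
  have h1 : coneRadon3 p f u θ = ∫ s in Ioi (0 : ℝ), g (s * cos θ) := by
    refine setIntegral_congr_fun measurableSet_Ioi fun s (hs : 0 < s) => ?_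
    have hsc : 0 < s * cos θ := mul_pos hs hθ
    have hst : s * cos θ * tan θ = s * sin θ := by
      rw [mul_assoc, mul_comm (cos θ), tan_mul_cos hθ.ne']
    simp only [hg]
    rw [integral_circleMeasure (φ := fun n => f (u + (s * sin θ) • n, s * cos θ) * (s * sin θ))
      (by fun_prop), hst, intervalIntegral.integral_mul_const]
    have h2 : ∀ β, f (u + (s * sin θ) • ang β, s * cos θ) =
        (s * cos θ) ^ p * weighted p f (u + (s * sin θ) • ang β, s * cos θ) :=
      fun β => (weighted_mul_rpow (q := (u + (s * sin θ) • ang β, s * cos θ)) hsc).symm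
    simp only [h2, intervalIntegral.integral_const_mul]
    rw [mul_rpow hs.le hθ.le, rpow_neg hs.le, ← hst]
    have := (rpow_pos_of_pos hs p).ne'
    field_simp
  have h3 : ∀ z, b ≤ z → g z = 0 := fun z hz => by
    have : ∀ w, weighted p f (w, z) = 0 := fun w =>
      image_eq_zero_of_notMem_tsupport fun hm => hfb w z hz (tsupport_weighted_subset hm)
    simp [hg, this]
  rw [h1, integral_comp_mul_right_Ioi _ _ hθ, zero_mul,
    setIntegral_eq_of_subset_of_forall_sdiff_eq_zero measurableSet_Ioi
      (Ioc_subset_Ioi_self : Ioc 0 b ⊆ Ioi 0)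
      fun z hz => h3 z (not_le.1 fun hle => hz.2 ⟨hz.1, hle⟩).le,
    ← intervalIntegral.integral_of_le hb, hg, intervalIntegral.integral_const_mul, smul_eq_mul,
    coneInt]
  ring

lemma lap2_const_mul {h : Plane → ℝ} (c : ℝ) (u : Plane) :
    lap2 (fun v => c * h v) u = c * lap2 h u := by
  have h1 : ∀ (k : Plane → ℝ) (v w : Plane),
      fderiv ℝ (fun v => c * k v) v w = c * fderiv ℝ k v w := fun k v w => by
    rw [show (fun v => c * k v) = c • k from rfl, fderiv_const_smul_field]
    rfl
  simp only [lap2, h1, Finset.mul_sum]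

lemma image_tan_Ioo_zero_pi_div_two : tan '' Ioo 0 (π / 2) = Ioi 0 := by
  ext t
  refine ⟨fun ⟨θ, hθ, h⟩ => h ▸ tan_pos_of_pos_of_lt_pi_div_two hθ.1 hθ.2, fun ht => ?_⟩
  exact ⟨arctan t, ⟨arctan_pos.2 ht, arctan_lt_pi_div_two t⟩, tan_arctan t⟩

lemma integral_Ioi_eq_integral_tan_s4 (g : ℝ → ℝ) :
    ∫ t in Ioi (0 : ℝ), g t = ∫ θ in Ioo (0 : ℝ) (π / 2), (1 / cos θ ^ 2) * g (tan θ) := by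
  have hsub : Ioo (0 : ℝ) (π / 2) ⊆ Ioo (-(π / 2)) (π / 2) :=
    Ioo_subset_Ioo_left (by linarith [pi_pos])
  rw [← image_tan_Ioo_zero_pi_div_two, integral_image_eq_integral_abs_deriv_smul
    measurableSet_Ioo
    (fun θ hθ => (hasDerivAt_tan_of_mem_Ioo (hsub hθ)).hasDerivWithinAt) (injOn_tan.mono hsub)]
  simp only [abs_of_nonneg (one_div_nonneg.2 (sq_nonneg (cos _))), smul_eq_mul]

/-- three-dimensional filtered back-projection, angle parametrization:
`f(x,y) = -(y^p/(4π²)) ∫_0^{π/2} cos θ^{-(1+p)} ∫_{S^1} (Δ_u R^(p) f)(x + y tan θ n, θ) dn dθ`. -/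
theorem coneRadon3_fbp_angle (p : ℝ) (f : EuclideanSpace ℝ (Fin 2) × ℝ → ℝ)
    (hf : ContDiff ℝ (⊤ : ℕ∞) f) (hfc : HasCompactSupport f)
    (hfs : tsupport f ⊆ {q : EuclideanSpace ℝ (Fin 2) × ℝ | 0 < q.2})
    (x : EuclideanSpace ℝ (Fin 2)) (y : ℝ) (hy : 0 < y) :
    f (x, y) =
      -(y ^ p / (4 * π ^ 2)) *
        ∫ θ in Set.Ioo (0 : ℝ) (π / 2),
          Real.cos θ ^ (-(1 + p)) *
            ∫ n, lap2 (fun u => coneRadon3 p f u θ)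
                (x + (y * Real.tan θ) • (n : EuclideanSpace ℝ (Fin 2)))
              ∂circleMeasure := by
  obtain ⟨M, hM⟩ := hfc.isBounded.exists_norm_le
  have hMb : ∀ q ∈ tsupport f, ‖q.1‖ ≤ M ∧ q.2 ≤ M := fun q hq =>
    ⟨(norm_fst_le q).trans (hM q hq), (le_abs_self _).trans ((norm_snd_le q).trans (hM q hq))⟩
  set b := |M| + 1
  set R := ‖x‖ + |M| + 1
  have hb : 0 ≤ b := by positivity
  have hR : 0 < R := by positivity
  have hfb : ∀ w z, b ≤ z → (w, z) ∉ tsupport f := fun w z hz hm => by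
    linarith [(hMb _ hm).2, le_abs_self M, show |M| + 1 ≤ z from hz]
  have hfR : ∀ w z, R ≤ ‖w‖ → (x + w, z) ∉ tsupport f := fun w z hw hm => by
    have := norm_sub_norm_le w (-x)
    rw [norm_neg, sub_neg_eq_add, add_comm w] at this
    linarith [(hMb _ hm).1, le_abs_self M, show ‖x‖ + |M| + 1 ≤ ‖w‖ from hw]
  have hh : ContDiff ℝ (⊤ : ℕ∞) (weighted p f) := contDiff_weighted hf hfs
  have hinv := integral_Ioi_coneMean hh x hR
    (fun w z hw hm => hfR w z hw (tsupport_weighted_subset hm)) hfc.weighted hb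
    (fun w z hz hm => hfb w z hz (tsupport_weighted_subset hm)) hy
  have hint : ∫ θ in Set.Ioo (0 : ℝ) (π / 2), Real.cos θ ^ (-(1 + p)) *
      ∫ n, lap2 (fun u => coneRadon3 p f u θ)
        (x + (y * Real.tan θ) • (n : EuclideanSpace ℝ (Fin 2))) ∂circleMeasure =
      ∫ t in Ioi (0 : ℝ), t * coneMean b (lapFst (weighted p f)) x y t := by
    rw [integral_Ioi_eq_integral_tan_s4]
    refine setIntegral_congr_fun measurableSet_Ioo fun θ hθ => ?_
    have hcos : 0 < cos θ := cos_pos_of_mem_Ioo ⟨by linarith [hθ.1, pi_pos], hθ.2⟩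
    have hcone : Continuous (coneInt b (lapFst (weighted p f)) (tan θ)) :=
      (continuous_coneInt hh.lapFst.continuous).comp
        (f := fun u : Plane => (tan θ, u)) (by fun_prop)
    simp only [coneRadon3_eq hf.continuous hb hfb hcos, lap2_const_mul, lap2_coneInt hh]
    rw [integral_const_mul, integral_circleMeasure
      (φ := fun n => coneInt b (lapFst (weighted p f)) (tan θ) (x + (y * tan θ) • n))
      (by fun_prop), ← coneMean, neg_add, rpow_add hcos, rpow_neg_one, rpow_neg hcos.le]
    have := (rpow_pos_of_pos hcos p).ne'
    field_simp
  rw [hint, hinv, ← weighted_mul_rpow (p := p) (f := f) (q := (x, y)) hy]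
  field_simp
end
end
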